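/- arXiv:math/0610895 — 3 statements merged into one kernel-verified Lean document; each statement's English description precedes it below -/
import Mathlib

section
/- In U_q(f(K,H)) the following identities hold: E·(EF) = (EF + f(q⁻²K, q²H))·E, F·(EF) = (EF − f(K,H))·F, EK = q⁻²KE, FK = q²KF, EH = q²HE, FH = q⁻²HF. Consequently, the subalgebra R of U_q(f(K,H)) generated by EF, K, K⁻¹, H, H⁻¹ is commutative, there is a unique ℂ-algebra automorphism θ of R with θ(K) = q⁻²K, θ(H) = q²H and θ(EF) = EF + f(q⁻²K, q²H), and for every a ∈ R one has Ea = θ(a)E and Fa = θ⁻¹(a)F, i.e. U_q(f(K,H)) is the hyperbolic algebra R{θ, ξ = EF} over R. -/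
set_option synthInstance.maxHeartbeats 1000000
set_option maxHeartbeats 1000000

noncomputable section

open FreeAlgebra

/-- Generators of the quantum group `U_q(f(K,H))`. -/
inductive Gen : Type
  | E | F | K | Kinv | H | Hinv

/-- The free algebra on the generators. -/
abbrev FA : Type := FreeAlgebra ℂ Gen

def gE : FA := ι ℂ Gen.E
def gF : FA := ι ℂ Gen.F
def gK : FA := ι ℂ Gen.K
def gKi : FA := ι ℂ Gen.Kinv
def gH : FA := ι ℂ Gen.H
def gHi : FA := ι ℂ Gen.Hinv

/-- The defining relations of `U_q(f(K,H))`, where `r` is the element of the free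
algebra representing the Laurent polynomial `f(K,H)` appearing in `EF - FE = f(K,H)`. -/
inductive URel (q : ℂ) (r : FA) : FA → FA → Prop
  | KKi : URel q r (gK * gKi) 1
  | KiK : URel q r (gKi * gK) 1
  | HHi : URel q r (gH * gHi) 1
  | HiH : URel q r (gHi * gH) 1
  | KH  : URel q r (gK * gH) (gH * gK)
  | KE  : URel q r (gK * gE) (q ^ 2 • (gE * gK))
  | KF  : URel q r (gK * gF) ((q ^ 2)⁻¹ • (gF * gK))
  | HE  : URel q r (gH * gE) ((q ^ 2)⁻¹ • (gE * gH))
  | HF  : URel q r (gH * gF) (q ^ 2 • (gF * gH))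
  | EF  : URel q r (gE * gF - gF * gE) r

/-- `U_q(f(K,H))` as a quotient of the free algebra. -/
abbrev Uq (q : ℂ) (r : FA) : Type := RingQuot (URel q r)

variable (q : ℂ) (r : FA)

def uE : Uq q r := RingQuot.mkAlgHom ℂ (URel q r) gE
def uF : Uq q r := RingQuot.mkAlgHom ℂ (URel q r) gF
def uK : Uq q r := RingQuot.mkAlgHom ℂ (URel q r) gK
def uKi : Uq q r := RingQuot.mkAlgHom ℂ (URel q r) gKi
def uH : Uq q r := RingQuot.mkAlgHom ℂ (URel q r) gH
def uHi : Uq q r := RingQuot.mkAlgHom ℂ (URel q r) gHi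

/-- The element `f_m(K,H) = (K^m - H^m)/(q - q⁻¹)` of the free algebra. -/
def fm (q : ℂ) (m : ℕ) : FA := (q - q⁻¹)⁻¹ • (gK ^ m - gH ^ m)

/-- The quantum group `U_q(f_m(K,H))`. -/
abbrev Um (q : ℂ) (m : ℕ) : Type := Uq q (fm q m)

end
noncomputable section
open FreeAlgebra

/-- `K^i` (for `i : ℤ`) in the free algebra, written using `K` and `K⁻¹`. -/
def zK (i : ℤ) : FA := gK ^ i.toNat * gKi ^ (-i).toNat

/-- `H^j` (for `j : ℤ`) in the free algebra, written using `H` and `H⁻¹`. -/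
def zH (j : ℤ) : FA := gH ^ j.toNat * gHi ^ (-j).toNat

/-- The element of the free algebra representing the Laurent polynomial
`f(K,H) = Σ_{(i,j)} P(i,j) K^i H^j ∈ ℂ[K^{±1}, H^{±1}]`, where the finitely supported
function `P : ℤ × ℤ →₀ ℂ` records the coefficients of `f`. -/
def evalKH (P : (ℤ × ℤ) →₀ ℂ) : FA :=
  P.sum fun ij c => c • (zK ij.1 * zH ij.2)

/-- The element of the free algebra representing
`f(q⁻²K, q²H) = Σ_{(i,j)} P(i,j) q^{2j-2i} K^i H^j`. -/
def evalKHtw (q : ℂ) (P : (ℤ × ℤ) →₀ ℂ) : FA :=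
  P.sum fun ij c => (c * q ^ (2 * ij.2 - 2 * ij.1)) • (zK ij.1 * zH ij.2)

/-- The image of `f(K,H)` in `U_q(f(K,H))`. -/
def uf (q : ℂ) (P : (ℤ × ℤ) →₀ ℂ) : Uq q (evalKH P) :=
  RingQuot.mkAlgHom ℂ (URel q (evalKH P)) (evalKH P)

/-- The image of `f(q⁻²K, q²H)` in `U_q(f(K,H))`. -/
def uftw (q : ℂ) (P : (ℤ × ℤ) →₀ ℂ) : Uq q (evalKH P) :=
  RingQuot.mkAlgHom ℂ (URel q (evalKH P)) (evalKHtw q P)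

/-- The commutative subalgebra `R` of `U_q(f(K,H))` generated by `EF, K, K⁻¹, H, H⁻¹`. -/
def R0 (q : ℂ) (r : FA) : Subalgebra ℂ (Uq q r) :=
  Algebra.adjoin ℂ ({uE q r * uF q r, uK q r, uKi q r, uH q r, uHi q r} : Set (Uq q r))

/-- `EF` as an element of `R`. -/
def rEF (q : ℂ) (r : FA) : R0 q r :=
  ⟨uE q r * uF q r, Algebra.subset_adjoin (by simp)⟩

/-- `K` as an element of `R`. -/
def rK (q : ℂ) (r : FA) : R0 q r :=
  ⟨uK q r, Algebra.subset_adjoin (by simp)⟩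

/-- `H` as an element of `R`. -/
def rH (q : ℂ) (r : FA) : R0 q r :=
  ⟨uH q r, Algebra.subset_adjoin (by simp)⟩

end

noncomputable section

namespace HyperbolicAlgebra

/-- The commutative algebra `ℂ[K^{±1}, H^{±1}, ξ]`, as a monoid algebra. -/
abbrev BaseAlg : Type :=
  MonoidAlgebra ℂ (Multiplicative ℤ × Multiplicative ℤ × Multiplicative ℕ)

namespace BaseAlg

/-- The unit `K` of `ℂ[K^{±1}, H^{±1}, ξ]`. -/
def K : BaseAlgˣ :=
  Units.map ((MonoidAlgebra.of ℂ _).comp (MonoidHom.inl _ _)) (toUnits (Multiplicative.ofAdd 1))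

/-- The unit `H` of `ℂ[K^{±1}, H^{±1}, ξ]`. -/
def H : BaseAlgˣ :=
  Units.map ((MonoidAlgebra.of ℂ _).comp ((MonoidHom.inr _ _).comp (MonoidHom.inl _ _)))
    (toUnits (Multiplicative.ofAdd 1))

/-- The variable `ξ` of `ℂ[K^{±1}, H^{±1}, ξ]`. -/
def X : BaseAlg := MonoidAlgebra.of ℂ _ (1, 1, Multiplicative.ofAdd 1)

theorem of_eq (i j : Multiplicative ℤ) (n : Multiplicative ℕ) :
    MonoidAlgebra.of ℂ (Multiplicative ℤ × Multiplicative ℤ × Multiplicative ℕ) (i, j, n) =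
      ((K ^ i.toAdd : BaseAlgˣ) : BaseAlg) * ((H ^ j.toAdd : BaseAlgˣ) : BaseAlg) *
        X ^ n.toAdd := by
  simp only [K, H, X, ← map_zpow, Units.coe_map, ← map_pow, ← map_mul, MonoidHom.coe_comp,
    Function.comp_apply, val_toUnits_apply, ← ofAdd_zsmul]
  congr 1
  ext <;> simp [← ofAdd_nsmul]

variable {B : Type*} [Ring B] [Algebra ℂ B]

theorem exists_algHom (k h : Bˣ) (t : B) (hkh : Commute k h) (hkt : Commute (k : B) t)
    (hht : Commute (h : B) t) :
    ∃ φ : BaseAlg →ₐ[ℂ] B, φ K = k ∧ φ H = h ∧ φ X = t := by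
  let fk : Multiplicative ℤ →* B := (Units.coeHom B).comp (zpowersHom Bˣ k)
  let fh : Multiplicative ℤ →* B := (Units.coeHom B).comp (zpowersHom Bˣ h)
  let ft : Multiplicative ℕ →* B := powersHom B t
  have h1 : ∀ m n, Commute (fh m) (ft n) := fun m n => by
    simpa [fh, ft] using ((hht.symm.units_zpow_right m.toAdd).symm.pow_right n.toAdd)
  have h2 : ∀ m n, Commute (fk m) (fh.noncommCoprod ft h1 n) := fun m n => by
    have a : Commute (fk m) (fh n.1) := by
      have := (hkh.zpow_zpow m.toAdd n.1.toAdd).map (Units.coeHom B)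
      simpa [fk, fh] using this
    have b : Commute (fk m) (ft n.2) := by
      simpa [fk, ft] using ((hkt.symm.units_zpow_right m.toAdd).symm.pow_right n.2.toAdd)
    exact a.mul_right b
  refine ⟨MonoidAlgebra.lift ℂ B _ (fk.noncommCoprod (fh.noncommCoprod ft h1) h2), ?_, ?_, ?_⟩
  · simp [K, fk]
  · simp [H, fh]
  · simp [X, ft]

theorem semiconjBy_of_generators {φ ψ : BaseAlg →ₐ[ℂ] B} {x : B}
    (hK : SemiconjBy x (φ K) (ψ K)) (hH : SemiconjBy x (φ H) (ψ H))
    (hX : SemiconjBy x (φ X) (ψ X)) (a : BaseAlg) : SemiconjBy x (φ a) (ψ a) := by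
  induction a using MonoidAlgebra.induction_on with
  | of m =>
    obtain ⟨i, j, n⟩ := m
    rw [of_eq]
    simp only [map_mul, map_pow]
    have hK' := SemiconjBy.units_zpow_right (x := Units.map (φ : BaseAlg →* B) K)
      (y := Units.map (ψ : BaseAlg →* B) K)
      hK i.toAdd
    have hH' := SemiconjBy.units_zpow_right (x := Units.map (φ : BaseAlg →* B) H)
      (y := Units.map (ψ : BaseAlg →* B) H)
      hH j.toAdd
    rw [← map_zpow, ← map_zpow] at hK' hH'
    exact (SemiconjBy.mul_right hK' hH').mul_right (hX.pow_right _)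
  | add a b ha hb => simpa using ha.add_right hb
  | smul c a ha =>
    simp only [map_smul]
    exact by simp [SemiconjBy, ha.eq]

theorem algHom_ext {φ ψ : BaseAlg →ₐ[ℂ] B} (hK : φ K = ψ K) (hH : φ H = ψ H)
    (hX : φ X = ψ X) : φ = ψ := by
  refine AlgHom.ext fun a => ?_
  simpa [SemiconjBy] using semiconjBy_of_generators (φ := φ) (ψ := ψ) (x := 1)
    (by simp [SemiconjBy, hK]) (by simp [SemiconjBy, hH]) (by simp [SemiconjBy, hX]) a

end BaseAlg

section Laurent

theorem coe_zpow_eq_toNat {M : Type*} [Monoid M] (u : Mˣ) (i : ℤ) :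
    ((u ^ i : Mˣ) : M) = (u : M) ^ i.toNat * ((u⁻¹ : Mˣ) : M) ^ (-i).toNat := by
  rw [← Units.val_pow_eq_pow_val, ← Units.val_pow_eq_pow_val, ← Units.val_mul, ← zpow_natCast,
    ← zpow_natCast, inv_zpow, ← zpow_neg, ← zpow_add]
  congr 2
  omega

variable {B C : Type*} [Ring B] [Algebra ℂ B] [Ring C] [Algebra ℂ C]

/-- The value at a pair of units of the Laurent polynomial with coefficients `P`. -/
def laurentEval (P : (ℤ × ℤ) →₀ ℂ) (k h : Bˣ) : B :=
  P.sum fun ij c => c • (((k ^ ij.1 : Bˣ) : B) * ((h ^ ij.2 : Bˣ) : B))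

theorem map_laurentEval (φ : B →ₐ[ℂ] C) (P : (ℤ × ℤ) →₀ ℂ) (k h : Bˣ) :
    φ (laurentEval P k h) = laurentEval P (Units.map φ k) (Units.map φ h) := by
  simp only [laurentEval, map_finsuppSum, map_smul, map_mul, ← map_zpow, Units.coe_map,
    MonoidHom.coe_coe]

theorem semiconjBy_laurentEval (P : (ℤ × ℤ) →₀ ℂ) {k h k' h' : Bˣ} {x : B}
    (hk : SemiconjBy x (k : B) k') (hh : SemiconjBy x (h : B) h') :
    SemiconjBy x (laurentEval P k h) (laurentEval P k' h') := by
  simp only [SemiconjBy, laurentEval, Finsupp.sum, Finset.mul_sum, Finset.sum_mul]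
  refine Finset.sum_congr rfl fun ij _ => ?_
  rw [mul_smul_comm, smul_mul_assoc,
    ((hk.units_zpow_right ij.1).mul_right (hh.units_zpow_right ij.2)).eq]

/-- Multiplication of a unit by a nonzero scalar. -/
def scaleUnit (c : ℂˣ) (u : Bˣ) : Bˣ := Units.map (algebraMap ℂ B) c * u

@[simp] theorem coe_scaleUnit (c : ℂˣ) (u : Bˣ) :
    ((scaleUnit c u : Bˣ) : B) = (c : ℂ) • (u : B) := by
  simp [scaleUnit, Algebra.smul_def]

theorem map_scaleUnit (φ : B →ₐ[ℂ] C) (c : ℂˣ) (u : Bˣ) :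
    Units.map (φ : B →* C) (scaleUnit c u) = scaleUnit c (Units.map (φ : B →* C) u) := by
  ext; simp

theorem coe_scaleUnit_zpow (c : ℂˣ) (u : Bˣ) (n : ℤ) :
    ((scaleUnit c u ^ n : Bˣ) : B) = ((c : ℂ) ^ n) • ((u ^ n : Bˣ) : B) := by
  have : Commute (Units.map (algebraMap ℂ B : ℂ →* B) c) u :=
    Units.ext (Algebra.commutes (c : ℂ) (u : B))
  rw [scaleUnit, this.mul_zpow, ← map_zpow]
  simp only [Algebra.smul_def, Units.val_mul, Units.coe_map, Units.val_zpow_eq_zpow_val]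
  rfl

theorem map_evalKH (g : FA →ₐ[ℂ] B) (k h : Bˣ) (hk : g gK = k) (hki : g gKi = (k⁻¹ : Bˣ))
    (hh : g gH = h) (hhi : g gHi = (h⁻¹ : Bˣ)) (P : (ℤ × ℤ) →₀ ℂ) :
    g (evalKH P) = laurentEval P k h := by
  simp only [evalKH, laurentEval, map_finsuppSum, map_smul, map_mul, map_pow, zK, zH, hk, hki,
    hh, hhi, coe_zpow_eq_toNat]

theorem map_evalKH_eq_map (φ : C →ₐ[ℂ] B) (g : FA →ₐ[ℂ] B) (k h : Cˣ) (hk : g gK = φ k)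
    (hki : g gKi = φ (k⁻¹ : Cˣ)) (hh : g gH = φ h) (hhi : g gHi = φ (h⁻¹ : Cˣ))
    (P : (ℤ × ℤ) →₀ ℂ) : g (evalKH P) = φ (laurentEval P k h) := by
  rw [map_laurentEval]
  exact map_evalKH g (Units.map (φ : C →* B) k) (Units.map (φ : C →* B) h) hk hki hh hhi P

theorem map_evalKHtw (g : FA →ₐ[ℂ] B) (k h : Bˣ) (hk : g gK = k) (hki : g gKi = (k⁻¹ : Bˣ))
    (hh : g gH = h) (hhi : g gHi = (h⁻¹ : Bˣ)) (P : (ℤ × ℤ) →₀ ℂ) (c : ℂˣ) :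
    g (evalKHtw c P) = laurentEval P (scaleUnit (c ^ 2)⁻¹ k) (scaleUnit (c ^ 2) h) := by
  simp only [evalKHtw, laurentEval, map_finsuppSum, map_smul, map_mul, map_pow, zK, zH, hk, hki,
    hh, hhi, coe_scaleUnit_zpow, ← coe_zpow_eq_toNat]
  refine Finsupp.sum_congr fun ij _ => ?_
  rw [smul_mul_smul_comm, smul_smul]
  congr 2
  simp only [Units.val_inv_eq_inv_val, Units.val_pow_eq_pow_val]
  rw [zpow_sub₀ c.ne_zero, zpow_mul, zpow_mul, inv_zpow, div_eq_inv_mul]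
  rfl

end Laurent

/-- The automorphism `K ↦ q⁻²K`, `H ↦ q²H`, `ξ ↦ ξ + f(q⁻²K, q²H)` of `ℂ[K^{±1}, H^{±1}, ξ]`,
with `c = q²`. -/
theorem exists_baseAlg_equiv (c : ℂˣ) (P : (ℤ × ℤ) →₀ ℂ) :
    ∃ σ : BaseAlg ≃ₐ[ℂ] BaseAlg,
      σ BaseAlg.K = ((c⁻¹ : ℂˣ) : ℂ) • (BaseAlg.K : BaseAlg) ∧
      σ BaseAlg.H = (c : ℂ) • (BaseAlg.H : BaseAlg) ∧
      σ BaseAlg.X = BaseAlg.X +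
        laurentEval P (scaleUnit c⁻¹ BaseAlg.K) (scaleUnit c BaseAlg.H) ∧
      σ.symm BaseAlg.K = (c : ℂ) • (BaseAlg.K : BaseAlg) ∧
      σ.symm BaseAlg.H = ((c⁻¹ : ℂˣ) : ℂ) • (BaseAlg.H : BaseAlg) ∧
      σ.symm BaseAlg.X = BaseAlg.X - laurentEval P BaseAlg.K BaseAlg.H := by
  obtain ⟨φ, h1, h2, h3⟩ := BaseAlg.exists_algHom (scaleUnit c⁻¹ BaseAlg.K)
    (scaleUnit c BaseAlg.H) (BaseAlg.X +
      laurentEval P (scaleUnit c⁻¹ BaseAlg.K) (scaleUnit c BaseAlg.H))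
    (.all _ _) (.all _ _) (.all _ _)
  obtain ⟨ψ, g1, g2, g3⟩ := BaseAlg.exists_algHom (scaleUnit c BaseAlg.K)
    (scaleUnit c⁻¹ BaseAlg.H) (BaseAlg.X - laurentEval P BaseAlg.K BaseAlg.H)
    (.all _ _) (.all _ _) (.all _ _)
  have e1 : Units.map (φ : BaseAlg →* BaseAlg) BaseAlg.K = scaleUnit c⁻¹ BaseAlg.K :=
    Units.ext h1
  have e2 : Units.map (φ : BaseAlg →* BaseAlg) BaseAlg.H = scaleUnit c BaseAlg.H :=
    Units.ext h2
  have f1 : Units.map (ψ : BaseAlg →* BaseAlg) (scaleUnit c⁻¹ BaseAlg.K) = BaseAlg.K :=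
    Units.ext (by simp [g1])
  have f2 : Units.map (ψ : BaseAlg →* BaseAlg) (scaleUnit c BaseAlg.H) = BaseAlg.H :=
    Units.ext (by simp [g2])
  refine ⟨AlgEquiv.ofAlgHom φ ψ ?_ ?_, ?_, ?_, h3, ?_, ?_, g3⟩
  · apply BaseAlg.algHom_ext
    · simp [g1, h1]
    · simp [g2, h2]
    · simp [g3, h3, map_laurentEval, e1, e2]
  · apply BaseAlg.algHom_ext
    · simp [g1, h1]
    · simp [g2, h2]
    · simp [g3, h3, map_laurentEval, f1, f2]
  · simp [h1]
  · simp [h2]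
  · simp [g1]
  · simp [g2]

section Presentation

variable (q : ℂ) (r : FA)

theorem uK_mul_uKi : uK q r * uKi q r = 1 := by
  simpa [uK, uKi] using RingQuot.mkAlgHom_rel ℂ (URel.KKi (q := q) (r := r))

theorem uKi_mul_uK : uKi q r * uK q r = 1 := by
  simpa [uK, uKi] using RingQuot.mkAlgHom_rel ℂ (URel.KiK (q := q) (r := r))

theorem uH_mul_uHi : uH q r * uHi q r = 1 := by
  simpa [uH, uHi] using RingQuot.mkAlgHom_rel ℂ (URel.HHi (q := q) (r := r))

theorem uHi_mul_uH : uHi q r * uH q r = 1 := by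
  simpa [uH, uHi] using RingQuot.mkAlgHom_rel ℂ (URel.HiH (q := q) (r := r))

theorem uK_mul_uH : uK q r * uH q r = uH q r * uK q r := by
  simpa [uK, uH] using RingQuot.mkAlgHom_rel ℂ (URel.KH (q := q) (r := r))

theorem uK_mul_uE : uK q r * uE q r = q ^ 2 • (uE q r * uK q r) := by
  simpa only [map_mul, map_smul, uK, uE] using RingQuot.mkAlgHom_rel ℂ (URel.KE (q := q) (r := r))

theorem uK_mul_uF : uK q r * uF q r = (q ^ 2)⁻¹ • (uF q r * uK q r) := by
  simpa only [map_mul, map_smul, uK, uF] using RingQuot.mkAlgHom_rel ℂ (URel.KF (q := q) (r := r))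

theorem uH_mul_uE : uH q r * uE q r = (q ^ 2)⁻¹ • (uE q r * uH q r) := by
  simpa only [map_mul, map_smul, uH, uE] using RingQuot.mkAlgHom_rel ℂ (URel.HE (q := q) (r := r))

theorem uH_mul_uF : uH q r * uF q r = q ^ 2 • (uF q r * uH q r) := by
  simpa only [map_mul, map_smul, uH, uF] using RingQuot.mkAlgHom_rel ℂ (URel.HF (q := q) (r := r))

theorem uE_mul_uF_sub (P : (ℤ × ℤ) →₀ ℂ) :
    uE q (evalKH P) * uF q (evalKH P) - uF q (evalKH P) * uE q (evalKH P) = uf q P := by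
  simpa only [map_mul, map_sub, uE, uF, uf] using
    RingQuot.mkAlgHom_rel ℂ (URel.EF (q := q) (r := evalKH P))

/-- `K` as a unit of `U_q(f(K,H))`. -/
def unitK : (Uq q r)ˣ := ⟨uK q r, uKi q r, uK_mul_uKi q r, uKi_mul_uK q r⟩

/-- `H` as a unit of `U_q(f(K,H))`. -/
def unitH : (Uq q r)ˣ := ⟨uH q r, uHi q r, uH_mul_uHi q r, uHi_mul_uH q r⟩

theorem uf_eq (P : (ℤ × ℤ) →₀ ℂ) :
    uf q P = laurentEval P (unitK q (evalKH P)) (unitH q (evalKH P)) :=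
  map_evalKH _ _ _ rfl rfl rfl rfl P

theorem uftw_eq (c : ℂˣ) (P : (ℤ × ℤ) →₀ ℂ) :
    uftw c P = laurentEval P (scaleUnit (c ^ 2)⁻¹ (unitK c (evalKH P)))
      (scaleUnit (c ^ 2) (unitH c (evalKH P))) :=
  map_evalKHtw _ _ _ rfl rfl rfl rfl P c

variable {q}

theorem uE_mul_uK (hq0 : q ≠ 0) : uE q r * uK q r = (q ^ 2)⁻¹ • (uK q r * uE q r) := by
  rw [uK_mul_uE, inv_smul_smul₀ (pow_ne_zero 2 hq0)]

theorem uF_mul_uK (hq0 : q ≠ 0) : uF q r * uK q r = q ^ 2 • (uK q r * uF q r) := by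
  rw [uK_mul_uF, smul_inv_smul₀ (pow_ne_zero 2 hq0)]

theorem uE_mul_uH (hq0 : q ≠ 0) : uE q r * uH q r = q ^ 2 • (uH q r * uE q r) := by
  rw [uH_mul_uE, smul_inv_smul₀ (pow_ne_zero 2 hq0)]

theorem uF_mul_uH (hq0 : q ≠ 0) : uF q r * uH q r = (q ^ 2)⁻¹ • (uH q r * uF q r) := by
  rw [uH_mul_uF, inv_smul_smul₀ (pow_ne_zero 2 hq0)]

theorem commute_uK_uE_mul_uF (hq0 : q ≠ 0) : Commute (uK q r) (uE q r * uF q r) := by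
  rw [Commute, SemiconjBy, ← mul_assoc, uK_mul_uE, smul_mul_assoc, mul_assoc, uK_mul_uF,
    mul_smul_comm, smul_inv_smul₀ (pow_ne_zero 2 hq0), mul_assoc]

theorem commute_uH_uE_mul_uF (hq0 : q ≠ 0) : Commute (uH q r) (uE q r * uF q r) := by
  rw [Commute, SemiconjBy, ← mul_assoc, uH_mul_uE, smul_mul_assoc, mul_assoc, uH_mul_uF,
    mul_smul_comm, inv_smul_smul₀ (pow_ne_zero 2 hq0), mul_assoc]

theorem uE_mul_uf (hq0 : q ≠ 0) (P : (ℤ × ℤ) →₀ ℂ) :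
    uE q (evalKH P) * uf q P = uftw q P * uE q (evalKH P) := by
  lift q to ℂˣ using hq0.isUnit
  rw [uf_eq, uftw_eq]
  apply semiconjBy_laurentEval
  · simpa [SemiconjBy, unitK] using uE_mul_uK (evalKH P) hq0
  · simpa [SemiconjBy, unitH] using uE_mul_uH (evalKH P) hq0

theorem uE_mul_uE_mul_uF (hq0 : q ≠ 0) (P : (ℤ × ℤ) →₀ ℂ) :
    uE q (evalKH P) * (uE q (evalKH P) * uF q (evalKH P)) =
      (uE q (evalKH P) * uF q (evalKH P) + uftw q P) * uE q (evalKH P) := by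
  rw [add_mul, ← uE_mul_uf hq0, ← uE_mul_uF_sub, mul_assoc, mul_sub, add_sub_cancel]

theorem uF_mul_uE_mul_uF (P : (ℤ × ℤ) →₀ ℂ) :
    uF q (evalKH P) * (uE q (evalKH P) * uF q (evalKH P)) =
      (uE q (evalKH P) * uF q (evalKH P) - uf q P) * uF q (evalKH P) := by
  rw [← uE_mul_uF_sub, sub_sub_cancel, mul_assoc]

end Presentation

section Representation

/-- Given an automorphism `σ` of a commutative algebra `A` with `σ(k) = q⁻²k`, `σ(h) = q²h` and
`σ⁻¹(x) = x - f(k,h)`, the algebra `U_q(f(K,H))` acts on `A`, with `E` acting as `σ` and `EF`,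
`K`, `H` acting by multiplication by `x`, `k`, `h`. -/
theorem exists_representation {A : Type*} [CommRing A] [Algebra ℂ A] (c : ℂˣ)
    (P : (ℤ × ℤ) →₀ ℂ) (σ : A ≃ₐ[ℂ] A) (k h : Aˣ) (x : A)
    (hk : σ k = (((c ^ 2)⁻¹ : ℂˣ) : ℂ) • (k : A)) (hh : σ h = ((c ^ 2 : ℂˣ) : ℂ) • (h : A))
    (hk' : σ.symm k = ((c ^ 2 : ℂˣ) : ℂ) • (k : A))
    (hh' : σ.symm h = (((c ^ 2)⁻¹ : ℂˣ) : ℂ) • (h : A))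
    (hx' : σ.symm x = x - laurentEval P k h) :
    ∃ ρ : Uq (c : ℂ) (evalKH P) →ₐ[ℂ] Module.End ℂ A,
      ρ (uE c (evalKH P) * uF c (evalKH P)) = Algebra.lmul ℂ A x ∧
      ρ (uK c (evalKH P)) = Algebra.lmul ℂ A k ∧
      ρ (uH c (evalKH P)) = Algebra.lmul ℂ A h := by
  obtain ⟨L, hL_def⟩ : ∃ L, L = Algebra.lmul ℂ A := ⟨_, rfl⟩
  rw [← hL_def]
  have hL (a b : A) : L a b = a * b := by rw [hL_def]; rfl
  have hx : σ (x - laurentEval P k h) = x := by rw [← hx', AlgEquiv.apply_symm_apply]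
  let gen : Gen → Module.End ℂ A := fun
    | .E => σ.toLinearMap
    | .F => σ.symm.toLinearMap * L x
    | .K => L k
    | .Kinv => L (k⁻¹ : Aˣ)
    | .H => L h
    | .Hinv => L (h⁻¹ : Aˣ)
  obtain ⟨g, hg⟩ : ∃ g : FA →ₐ[ℂ] Module.End ℂ A, ∀ i, g (FreeAlgebra.ι ℂ i) = gen i :=
    ⟨FreeAlgebra.lift ℂ gen, FreeAlgebra.lift_ι_apply _⟩
  have gE' : g gE = σ.toLinearMap := hg _
  have gF' : g gF = σ.symm.toLinearMap * L x := hg _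
  have gK' : g gK = L k := hg _
  have gKi' : g gKi = L (k⁻¹ : Aˣ) := hg _
  have gH' : g gH = L h := hg _
  have gHi' : g gHi = L (h⁻¹ : Aˣ) := hg _
  have gf : g (evalKH P) = L (laurentEval P k h) :=
    map_evalKH_eq_map L g k h gK' gKi' gH' gHi' P
  have hrel : ∀ ⦃x y : FA⦄, URel c (evalKH P) x y → g x = g y := by
    rintro _ _ (_ | _ | _ | _ | _ | _ | _ | _ | _ | _) <;>
      simp only [map_mul, map_one, map_smul, map_sub, gE', gF', gK', gKi', gH', gHi', gf] <;>
      refine LinearMap.ext fun a => ?_ <;>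
      simp only [Module.End.mul_apply, Module.End.one_apply, LinearMap.smul_apply,
        LinearMap.sub_apply, hL, AlgEquiv.toLinearMap_apply, map_mul, hk, hh, hk', hh', hx', hx,
        AlgEquiv.apply_symm_apply, AlgEquiv.symm_apply_apply, Units.mul_inv_cancel_left,
        Units.inv_mul_cancel_left, smul_mul_assoc, smul_smul, Units.val_inv_eq_inv_val,
        Units.val_pow_eq_pow_val, mul_smul_comm, ne_eq, OfNat.ofNat_ne_zero,
        not_false_eq_true, pow_eq_zero_iff, Units.ne_zero, mul_inv_cancel₀, inv_mul_cancel₀,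
        one_smul]
    all_goals ring
  refine ⟨RingQuot.liftAlgHom ℂ ⟨g, hrel⟩, ?_, ?_, ?_⟩
  · simp only [uE, uF, map_mul, RingQuot.liftAlgHom_mkAlgHom_apply, gE', gF']
    refine LinearMap.ext fun a => ?_
    simp [hL]
  · exact (RingQuot.liftAlgHom_mkAlgHom_apply ℂ g hrel _).trans gK'
  · exact (RingQuot.liftAlgHom_mkAlgHom_apply ℂ g hrel _).trans gH'

/-- The subalgebra `R` is isomorphic to `ℂ[K^{±1}, H^{±1}, ξ]`. -/
theorem exists_R0_equiv (c : ℂˣ) (P : (ℤ × ℤ) →₀ ℂ) :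
    ∃ e : BaseAlg ≃ₐ[ℂ] R0 (c : ℂ) (evalKH P),
      e BaseAlg.K = rK c (evalKH P) ∧ e BaseAlg.H = rH c (evalKH P) ∧
      e BaseAlg.X = rEF c (evalKH P) := by
  set r := evalKH P
  let k : (R0 (c : ℂ) r)ˣ :=
    ⟨rK c r, ⟨uKi c r, Algebra.subset_adjoin (by simp)⟩, Subtype.ext (uK_mul_uKi _ _),
      Subtype.ext (uKi_mul_uK _ _)⟩
  let h : (R0 (c : ℂ) r)ˣ :=
    ⟨rH c r, ⟨uHi c r, Algebra.subset_adjoin (by simp)⟩, Subtype.ext (uH_mul_uHi _ _),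
      Subtype.ext (uHi_mul_uH _ _)⟩
  obtain ⟨φ, h1, h2, h3⟩ := BaseAlg.exists_algHom k h (rEF c r)
    (Units.ext (Subtype.ext (uK_mul_uH _ _)))
    (Subtype.ext (commute_uK_uE_mul_uF r c.ne_zero).eq)
    (Subtype.ext (commute_uH_uE_mul_uF r c.ne_zero).eq)
  obtain ⟨σ, s1, s2, -, s3, s4, s5⟩ := exists_baseAlg_equiv (c ^ 2) P
  obtain ⟨ρ, g3, g1, g2⟩ := exists_representation c P σ _ _ _ s1 s2 s3 s4 s5
  have hρ : (ρ.comp (R0 (c : ℂ) r).val).comp φ = Algebra.lmul ℂ BaseAlg := by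
    apply BaseAlg.algHom_ext
    · exact (congrArg (fun y : R0 (c : ℂ) r => ρ y) h1).trans g1
    · exact (congrArg (fun y : R0 (c : ℂ) r => ρ y) h2).trans g2
    · exact (congrArg (fun y : R0 (c : ℂ) r => ρ y) h3).trans g3
  have hinj : Function.Injective φ := by
    have : Function.Injective ((ρ.comp (R0 (c : ℂ) r).val).comp φ) :=
      hρ ▸ Algebra.lmul_injective
    exact Function.Injective.of_comp (f := ρ.comp (R0 (c : ℂ) r).val) this
  have hsurj : Function.Surjective φ := by
    have hle : R0 (c : ℂ) r ≤ ((R0 (c : ℂ) r).val.comp φ).range := by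
      refine Algebra.adjoin_le ?_
      rintro _ (rfl | rfl | rfl | rfl | rfl)
      · exact ⟨BaseAlg.X, congrArg Subtype.val h3⟩
      · exact ⟨BaseAlg.K, congrArg Subtype.val h1⟩
      · exact ⟨(BaseAlg.K⁻¹ : BaseAlgˣ), congrArg (fun u : (R0 (c : ℂ) r)ˣ => (u⁻¹).1.1)
          (Units.ext h1 : Units.map (φ : BaseAlg →* _) BaseAlg.K = k)⟩
      · exact ⟨BaseAlg.H, congrArg Subtype.val h2⟩
      · exact ⟨(BaseAlg.H⁻¹ : BaseAlgˣ), congrArg (fun u : (R0 (c : ℂ) r)ˣ => (u⁻¹).1.1)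
          (Units.ext h2 : Units.map (φ : BaseAlg →* _) BaseAlg.H = h)⟩
    intro x
    obtain ⟨a, ha⟩ := hle x.2
    exact ⟨a, Subtype.ext ha⟩
  exact ⟨AlgEquiv.ofBijective φ ⟨hinj, hsurj⟩, h1, h2, h3⟩

/-- The automorphism `θ` of `R` describing `U_q(f(K,H))` as a hyperbolic algebra over `R`. -/
theorem exists_R0_automorphism (c : ℂˣ) (P : (ℤ × ℤ) →₀ ℂ) :
    ∃ θ : R0 (c : ℂ) (evalKH P) ≃ₐ[ℂ] R0 (c : ℂ) (evalKH P),
      (((θ (rK c (evalKH P)) : Uq (c : ℂ) (evalKH P)) = ((c : ℂ) ^ 2)⁻¹ • uK c (evalKH P) ∧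
       (θ (rH c (evalKH P)) : Uq (c : ℂ) (evalKH P)) = (c : ℂ) ^ 2 • uH c (evalKH P) ∧
       (θ (rEF c (evalKH P)) : Uq (c : ℂ) (evalKH P)) =
         uE c (evalKH P) * uF c (evalKH P) + uftw c P) ∧
      ∀ a : R0 (c : ℂ) (evalKH P),
        uE c (evalKH P) * (a : Uq (c : ℂ) (evalKH P)) =
          (θ a : Uq (c : ℂ) (evalKH P)) * uE c (evalKH P) ∧
        uF c (evalKH P) * (a : Uq (c : ℂ) (evalKH P)) =
          (θ.symm a : Uq (c : ℂ) (evalKH P)) * uF c (evalKH P)) := by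
  obtain ⟨e, hK, hH, hX⟩ := exists_R0_equiv c P
  obtain ⟨σ, s1, s2, s3, s4, s5, s6⟩ := exists_baseAlg_equiv (c ^ 2) P
  let φ : BaseAlg →ₐ[ℂ] Uq (c : ℂ) (evalKH P) := (R0 (c : ℂ) (evalKH P)).val.comp e
  have hK' : φ BaseAlg.K = uK c (evalKH P) := congrArg Subtype.val hK
  have hH' : φ BaseAlg.H = uH c (evalKH P) := congrArg Subtype.val hH
  have hX' : φ BaseAlg.X = uE c (evalKH P) * uF c (evalKH P) := congrArg Subtype.val hX
  have uK' : Units.map (φ : BaseAlg →* Uq (c : ℂ) (evalKH P)) BaseAlg.K = unitK c (evalKH P) :=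
    Units.ext hK'
  have uH' : Units.map (φ : BaseAlg →* Uq (c : ℂ) (evalKH P)) BaseAlg.H = unitH c (evalKH P) :=
    Units.ext hH'
  have hf : φ (laurentEval P BaseAlg.K BaseAlg.H) = uf c P := by
    rw [map_laurentEval, uf_eq, uK', uH']
  have hftw : φ (laurentEval P (scaleUnit (c ^ 2)⁻¹ BaseAlg.K) (scaleUnit (c ^ 2) BaseAlg.H)) =
      uftw c P := by
    rw [map_laurentEval, uftw_eq, map_scaleUnit, map_scaleUnit, uK', uH']
  have t1 : φ (σ BaseAlg.K) = ((c : ℂ) ^ 2)⁻¹ • uK c (evalKH P) := by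
    rw [s1, map_smul, hK', Units.val_inv_eq_inv_val, Units.val_pow_eq_pow_val]
  have t2 : φ (σ BaseAlg.H) = (c : ℂ) ^ 2 • uH c (evalKH P) := by
    rw [s2, map_smul, hH', Units.val_pow_eq_pow_val]
  have t3 : φ (σ BaseAlg.X) = uE c (evalKH P) * uF c (evalKH P) + uftw c P := by
    rw [s3, map_add, hX', hftw]
  have t4 : φ (σ.symm BaseAlg.K) = (c : ℂ) ^ 2 • uK c (evalKH P) := by
    rw [s4, map_smul, hK', Units.val_pow_eq_pow_val]
  have t5 : φ (σ.symm BaseAlg.H) = ((c : ℂ) ^ 2)⁻¹ • uH c (evalKH P) := by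
    rw [s5, map_smul, hH', Units.val_inv_eq_inv_val, Units.val_pow_eq_pow_val]
  have t6 : φ (σ.symm BaseAlg.X) = uE c (evalKH P) * uF c (evalKH P) - uf c P := by
    rw [s6, map_sub, hX', hf]
  have hE (a : BaseAlg) : uE c (evalKH P) * φ a = φ (σ a) * uE c (evalKH P) := by
    refine BaseAlg.semiconjBy_of_generators (φ := φ) (ψ := φ.comp σ) ?_ ?_ ?_ a
    · change _ * φ _ = φ (σ _) * _
      rw [hK', t1, uE_mul_uK (evalKH P) c.ne_zero, smul_mul_assoc]
    · change _ * φ _ = φ (σ _) * _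
      rw [hH', t2, uE_mul_uH (evalKH P) c.ne_zero, smul_mul_assoc]
    · change _ * φ _ = φ (σ _) * _
      rw [hX', t3, uE_mul_uE_mul_uF c.ne_zero]
  have hF (a : BaseAlg) : uF c (evalKH P) * φ a = φ (σ.symm a) * uF c (evalKH P) := by
    refine BaseAlg.semiconjBy_of_generators (φ := φ) (ψ := φ.comp σ.symm) ?_ ?_ ?_ a
    · change _ * φ _ = φ (σ.symm _) * _
      rw [hK', t4, uF_mul_uK (evalKH P) c.ne_zero, smul_mul_assoc]
    · change _ * φ _ = φ (σ.symm _) * _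
      rw [hH', t5, uF_mul_uH (evalKH P) c.ne_zero, smul_mul_assoc]
    · change _ * φ _ = φ (σ.symm _) * _
      rw [hX', t6, uF_mul_uE_mul_uF]
  refine ⟨(e.symm.trans σ).trans e, ⟨?_, ?_, ?_⟩, fun a => ?_⟩
  · rw [← hK]
    change φ (σ (e.symm (e _))) = _
    rw [e.symm_apply_apply, t1]
  · rw [← hH]
    change φ (σ (e.symm (e _))) = _
    rw [e.symm_apply_apply, t2]
  · rw [← hX]
    change φ (σ (e.symm (e _))) = _
    rw [e.symm_apply_apply, t3]
  · obtain ⟨b, rfl⟩ := e.surjective a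
    constructor
    · change _ = φ (σ (e.symm (e b))) * _
      rw [e.symm_apply_apply]
      exact hE b
    · change _ = φ (σ.symm (e.symm (e b))) * _
      rw [e.symm_apply_apply]
      exact hF b

end Representation

end HyperbolicAlgebra

end

/-- In `U_q(f(K,H))`: `E(EF) = (EF + f(q⁻²K, q²H))E`,
`F(EF) = (EF - f(K,H))F`, `EK = q⁻²KE`, `FK = q²KF`, `EH = q²HE`, `FH = q⁻²HF`;
the subalgebra `R` generated by `EF, K, K⁻¹, H, H⁻¹` is commutative; there is a unique
ℂ-algebra automorphism `θ` of `R` with `θ(K) = q⁻²K`, `θ(H) = q²H`,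
`θ(EF) = EF + f(q⁻²K, q²H)` satisfying `Ea = θ(a)E` and `Fa = θ⁻¹(a)F` for all `a ∈ R`;
thus `U_q(f(K,H))` is the hyperbolic algebra `R{θ, ξ = EF}`. -/
theorem stmt0 (q : ℂ) (hq0 : q ≠ 0) (hq2 : q ^ 2 ≠ 1) (P : (ℤ × ℤ) →₀ ℂ) :
    (uE q (evalKH P) * (uE q (evalKH P) * uF q (evalKH P)) =
      (uE q (evalKH P) * uF q (evalKH P) + uftw q P) * uE q (evalKH P)) ∧
    (uF q (evalKH P) * (uE q (evalKH P) * uF q (evalKH P)) =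
      (uE q (evalKH P) * uF q (evalKH P) - uf q P) * uF q (evalKH P)) ∧
    (uE q (evalKH P) * uK q (evalKH P) =
      (q ^ 2)⁻¹ • (uK q (evalKH P) * uE q (evalKH P))) ∧
    (uF q (evalKH P) * uK q (evalKH P) =
      q ^ 2 • (uK q (evalKH P) * uF q (evalKH P))) ∧
    (uE q (evalKH P) * uH q (evalKH P) =
      q ^ 2 • (uH q (evalKH P) * uE q (evalKH P))) ∧
    (uF q (evalKH P) * uH q (evalKH P) =
      (q ^ 2)⁻¹ • (uH q (evalKH P) * uF q (evalKH P))) ∧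
    (∀ a ∈ R0 q (evalKH P), ∀ b ∈ R0 q (evalKH P), a * b = b * a) ∧
    (∃! θ : R0 q (evalKH P) ≃ₐ[ℂ] R0 q (evalKH P),
      ((θ (rK q (evalKH P)) : Uq q (evalKH P)) = (q ^ 2)⁻¹ • uK q (evalKH P) ∧
       (θ (rH q (evalKH P)) : Uq q (evalKH P)) = q ^ 2 • uH q (evalKH P) ∧
       (θ (rEF q (evalKH P)) : Uq q (evalKH P)) =
         uE q (evalKH P) * uF q (evalKH P) + uftw q P) ∧
      ∀ a : R0 q (evalKH P),
        uE q (evalKH P) * (a : Uq q (evalKH P)) = (θ a : Uq q (evalKH P)) * uE q (evalKH P) ∧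
        uF q (evalKH P) * (a : Uq q (evalKH P)) =
          (θ.symm a : Uq q (evalKH P)) * uF q (evalKH P)) := by
  lift q to ℂˣ using hq0.isUnit
  obtain ⟨e, hK, hH, hX⟩ := HyperbolicAlgebra.exists_R0_equiv q P
  refine ⟨HyperbolicAlgebra.uE_mul_uE_mul_uF hq0 P, HyperbolicAlgebra.uF_mul_uE_mul_uF P,
    HyperbolicAlgebra.uE_mul_uK _ hq0, HyperbolicAlgebra.uF_mul_uK _ hq0,
    HyperbolicAlgebra.uE_mul_uH _ hq0, HyperbolicAlgebra.uF_mul_uH _ hq0, ?_, ?_⟩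
  · intro a ha b hb
    obtain ⟨x, hx⟩ := e.surjective ⟨a, ha⟩
    obtain ⟨y, hy⟩ := e.surjective ⟨b, hb⟩
    have h : e x * e y = e y * e x := by rw [← map_mul, mul_comm, map_mul]
    rw [hx, hy] at h
    exact congrArg Subtype.val h
  · obtain ⟨θ, hθ⟩ := HyperbolicAlgebra.exists_R0_automorphism q P
    refine ⟨θ, hθ, fun θ' hθ' => ?_⟩
    have h : θ'.toAlgHom.comp e.toAlgHom = θ.toAlgHom.comp e.toAlgHom := by
      apply HyperbolicAlgebra.BaseAlg.algHom_ext (B := R0 (q : ℂ) (evalKH P))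
      · change θ' (e _) = θ (e _)
        rw [hK]
        exact Subtype.ext (hθ'.1.1.trans hθ.1.1.symm)
      · change θ' (e _) = θ (e _)
        rw [hH]
        exact Subtype.ext (hθ'.1.2.1.trans hθ.1.2.1.symm)
      · change θ' (e _) = θ (e _)
        rw [hX]
        exact Subtype.ext (hθ'.1.2.2.trans hθ.1.2.2.symm)
    refine AlgEquiv.ext fun a => ?_
    obtain ⟨b, rfl⟩ := e.surjective a
    exact DFunLike.congr_fun h b
end

section
/- The algebra U_q(f(K,H)) is a left and right noetherian integral domain. -/
set_option synthInstance.maxHeartbeats 1000000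
set_option maxHeartbeats 1000000

/-- An additive subgroup containing `1` and stable under left multiplication by a set of ring
generators is the whole ring. -/
theorem AddSubgroup.mem_of_closure_eq_top {S : Type*} [Ring S] {G : Set S}
    (hG : Subring.closure G = ⊤) (W : AddSubgroup S) (h1 : (1 : S) ∈ W)
    (hW : ∀ g ∈ G, ∀ w ∈ W, g * w ∈ W) (s : S) : s ∈ W := by
  have key : ∀ w ∈ W, s * w ∈ W := by
    have hs : s ∈ Subring.closure G := hG ▸ Subring.mem_top s
    induction hs using Subring.closure_induction with
    | mem g hg => exact hW g hg
    | zero => intro w _; simp [W.zero_mem]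
    | one => intro w hw; simpa using hw
    | add a b _ _ ha hb => intro w hw; rw [add_mul]; exact W.add_mem (ha w hw) (hb w hw)
    | neg a _ ha => intro w hw; rw [neg_mul]; exact W.neg_mem (ha w hw)
    | mul a b _ _ ha hb => intro w hw; rw [mul_assoc]; exact ha _ (hb w hw)
  simpa using key 1 h1

namespace OreNoetherian

variable {R S : Type*} [Ring R] [Ring S] (j : R →+* S) (x : S)

/-- The sums of elements `x ^ i * j r` with `i < n`. -/
def degreeLT (n : ℕ) : AddSubgroup S :=
  AddSubgroup.closure {s | ∃ i < n, ∃ r, s = x ^ i * j r}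

variable {j x}

theorem pow_mul_mem {i n : ℕ} (h : i < n) (r : R) : x ^ i * j r ∈ degreeLT j x n :=
  AddSubgroup.subset_closure ⟨i, h, r, rfl⟩

theorem degreeLT_mono {m n : ℕ} (h : m ≤ n) : degreeLT j x m ≤ degreeLT j x n := by
  refine (AddSubgroup.closure_le _).2 ?_
  rintro _ ⟨i, hi, r, rfl⟩
  exact pow_mul_mem (hi.trans_le h) r

theorem mul_mem_succ {n : ℕ} {u : S} (hu : u ∈ degreeLT j x n) :
    x * u ∈ degreeLT j x (n + 1) := by
  induction hu using AddSubgroup.closure_induction with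
  | mem s hs =>
    obtain ⟨i, hi, r, rfl⟩ := hs
    rw [← mul_assoc, ← pow_succ']
    exact pow_mul_mem (by omega) r
  | zero => simp
  | add a b _ _ ha hb => rw [mul_add]; exact AddSubgroup.add_mem _ ha hb
  | neg a _ ha => rw [mul_neg]; exact AddSubgroup.neg_mem _ ha

theorem mul_map_mem {n : ℕ} {u : S} (hu : u ∈ degreeLT j x n) (r : R) :
    u * j r ∈ degreeLT j x n := by
  induction hu using AddSubgroup.closure_induction with
  | mem s hs =>
    obtain ⟨i, hi, r', rfl⟩ := hs
    rw [mul_assoc, ← map_mul]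
    exact pow_mul_mem hi _
  | zero => simp
  | add a b _ _ ha hb => rw [add_mul]; exact AddSubgroup.add_mem _ ha hb
  | neg a _ ha => rw [neg_mul]; exact AddSubgroup.neg_mem _ ha

theorem exists_map_mul_pow (h : ∀ r, ∃ a b, j r * x = x * j a + j b) (n : ℕ) :
    ∀ s, ∃ t, j s * x ^ n - x ^ n * j t ∈ degreeLT j x n := by
  induction n with
  | zero => exact fun s => ⟨s, by simp⟩
  | succ n ih =>
    intro s
    obtain ⟨a, b, hab⟩ := h s
    obtain ⟨t, ht⟩ := ih a
    obtain ⟨t', ht'⟩ := ih b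
    refine ⟨t, ?_⟩
    have e : j s * x ^ (n + 1) - x ^ (n + 1) * j t =
        x * (j a * x ^ n - x ^ n * j t) + (j b * x ^ n - x ^ n * j t') + x ^ n * j t' := by
      rw [pow_succ', ← mul_assoc, hab]; noncomm_ring
    rw [e]
    exact add_mem (add_mem (mul_mem_succ ht) (degreeLT_mono n.le_succ ht'))
      (pow_mul_mem n.lt_succ_self _)

theorem map_mul_mem (h : ∀ r, ∃ a b, j r * x = x * j a + j b) {n : ℕ} {u : S}
    (hu : u ∈ degreeLT j x n) (s : R) : j s * u ∈ degreeLT j x n := by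
  induction hu using AddSubgroup.closure_induction with
  | mem v hv =>
    obtain ⟨i, hi, r, rfl⟩ := hv
    obtain ⟨t, ht⟩ := exists_map_mul_pow h i s
    have e : j s * (x ^ i * j r) = (j s * x ^ i - x ^ i * j t) * j r + x ^ i * j (t * r) := by
      rw [map_mul]; noncomm_ring
    rw [e]
    exact add_mem (mul_map_mem (degreeLT_mono hi.le ht) r) (pow_mul_mem hi _)
  | zero => simp
  | add a b _ _ ha hb => rw [mul_add]; exact AddSubgroup.add_mem _ ha hb
  | neg a _ ha => rw [mul_neg]; exact AddSubgroup.neg_mem _ ha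

theorem exists_pow_mul_map (h : ∀ r, ∃ a b, j r * x = x * j a + j b)
    (hswap : ∀ r, ∃ a b, x * j r = j a * x + j b) (n : ℕ) :
    ∀ s, ∃ t, j t * x ^ n - x ^ n * j s ∈ degreeLT j x n := by
  induction n with
  | zero => exact fun s => ⟨s, by simp⟩
  | succ n ih =>
    intro s
    obtain ⟨t, ht⟩ := ih s
    obtain ⟨a, b, hab⟩ := hswap t
    refine ⟨a, ?_⟩
    have e : j a * x ^ (n + 1) - x ^ (n + 1) * j s =
        x * (j t * x ^ n - x ^ n * j s) - j b * (x ^ n * j 1) := by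
      rw [mul_sub, ← mul_assoc x, hab, map_one, pow_succ']; noncomm_ring
    rw [e]
    exact sub_mem (mul_mem_succ ht) (map_mul_mem h (pow_mul_mem n.lt_succ_self _) b)

theorem exists_eq_of_mem_succ {n : ℕ} {u : S} (hu : u ∈ degreeLT j x (n + 1)) :
    ∃ r, ∃ p ∈ degreeLT j x n, u = x ^ n * j r + p := by
  induction hu using AddSubgroup.closure_induction with
  | mem v hv =>
    obtain ⟨i, hi, r, rfl⟩ := hv
    rcases Nat.lt_succ_iff_lt_or_eq.1 hi with hi | rfl
    · exact ⟨0, _, pow_mul_mem hi r, by simp⟩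
    · exact ⟨r, 0, zero_mem _, by simp⟩
  | zero => exact ⟨0, 0, zero_mem _, by simp⟩
  | add a b _ _ ha hb =>
    obtain ⟨r, p, hp, rfl⟩ := ha
    obtain ⟨r', p', hp', rfl⟩ := hb
    exact ⟨r + r', p + p', add_mem hp hp', by rw [map_add]; noncomm_ring⟩
  | neg a _ ha =>
    obtain ⟨r, p, hp, rfl⟩ := ha
    exact ⟨-r, -p, neg_mem hp, by rw [map_neg]; noncomm_ring⟩

/-- The left ideal of the coefficients of `x ^ n` in the elements of degree at most `n` of a
left ideal. -/
def leadingCoeff (h : ∀ r, ∃ a b, j r * x = x * j a + j b)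
    (hswap : ∀ r, ∃ a b, x * j r = j a * x + j b) (I : Ideal S) (n : ℕ) : Ideal R where
  carrier := {r | ∃ p ∈ degreeLT j x n, x ^ n * j r + p ∈ I}
  zero_mem' := ⟨0, zero_mem _, by simp⟩
  add_mem' := by
    rintro a b ⟨p, hp, hpI⟩ ⟨p', hp', hpI'⟩
    refine ⟨p + p', add_mem hp hp', ?_⟩
    convert! I.add_mem hpI hpI' using 1
    rw [map_add]; noncomm_ring
  smul_mem' := by
    rintro s r ⟨p, hp, hpI⟩
    obtain ⟨t, ht⟩ := exists_pow_mul_map h hswap n s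
    refine ⟨(j t * x ^ n - x ^ n * j s) * j r + j t * p,
      add_mem (mul_map_mem ht r) (map_mul_mem h hp t), ?_⟩
    convert! I.mul_mem_left (j t) hpI using 1
    rw [smul_eq_mul, map_mul]; noncomm_ring

variable (h : ∀ r, ∃ a b, j r * x = x * j a + j b) (hswap : ∀ r, ∃ a b, x * j r = j a * x + j b)

theorem leadingCoeff_mono {I J : Ideal S} (hIJ : I ≤ J) {m n : ℕ} (hmn : m ≤ n) :
    leadingCoeff h hswap I m ≤ leadingCoeff h hswap J n := by
  induction n, hmn using Nat.le_induction with
  | base => exact fun r ⟨p, hp, hpI⟩ => ⟨p, hp, hIJ hpI⟩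
  | succ n _ ih =>
    intro r hr
    obtain ⟨p, hp, hpJ⟩ := ih hr
    refine ⟨x * p, mul_mem_succ hp, ?_⟩
    convert! J.mul_mem_left x hpJ using 1
    rw [pow_succ']; noncomm_ring

theorem mem_of_leadingCoeff_le {I J : Ideal S} (hIJ : I ≤ J)
    (hL : ∀ n, leadingCoeff h hswap J n ≤ leadingCoeff h hswap I n) (n : ℕ) :
    ∀ u ∈ J, u ∈ degreeLT j x n → u ∈ I := by
  induction n with
  | zero =>
    intro u _ hu
    have : degreeLT j x 0 = ⊥ := by simp [degreeLT]
    rw [this, AddSubgroup.mem_bot] at hu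
    simp [hu]
  | succ n ih =>
    intro u huJ hu
    obtain ⟨r, p, hp, rfl⟩ := exists_eq_of_mem_succ hu
    obtain ⟨p', hp', hI⟩ := hL n ⟨p, hp, huJ⟩
    have hd : p - p' ∈ I := by
      refine ih _ ?_ (sub_mem hp hp')
      convert! J.sub_mem huJ (hIJ hI) using 1
      abel
    convert! I.add_mem hI hd using 1
    abel

include h hswap in
/-- A noncommutative Hilbert basis theorem. -/
theorem isNoetherianRing_of_closure [IsNoetherianRing R]
    (hgen : Subring.closure (Set.range j ∪ {x}) = ⊤) : IsNoetherianRing S := by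
  have hex : ∀ u : S, ∃ n, u ∈ degreeLT j x n := by
    intro u
    have hdir : Directed (· ≤ ·) (degreeLT j x) :=
      (monotone_nat_of_le_succ fun n => degreeLT_mono n.le_succ).directed_le
    rw [← AddSubgroup.mem_iSup_of_directed hdir]
    refine AddSubgroup.mem_of_closure_eq_top hgen _ ?_ ?_ u
    · rw [AddSubgroup.mem_iSup_of_directed hdir]
      exact ⟨1, by simpa using pow_mul_mem (j := j) (x := x) zero_lt_one 1⟩
    · intro g hg w hw
      rw [AddSubgroup.mem_iSup_of_directed hdir] at hw ⊢
      obtain ⟨n, hn⟩ := hw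
      rcases hg with ⟨r, rfl⟩ | rfl
      · exact ⟨n, map_mul_mem h hn r⟩
      · exact ⟨n + 1, mul_mem_succ hn⟩
  refine monotone_stabilizes_iff_noetherian.1 fun I => ?_
  set L := leadingCoeff h hswap with hL
  have stab : ∀ c : ℕ →o Ideal R, ∃ N, ∀ m, N ≤ m → c N = c m :=
    monotone_stabilizes_iff_noetherian.2 inferInstance
  obtain ⟨N, hN⟩ := stab ⟨fun k => L (I k) k, fun a b hab => leadingCoeff_mono h hswap (I.2 hab) hab⟩
  choose K hK using fun n =>
    stab ⟨fun k => L (I k) n, fun a b hab => leadingCoeff_mono h hswap (I.2 hab) le_rfl⟩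
  obtain ⟨M, hM⟩ := ((Finset.range N).image K).bddAbove
  refine ⟨max N M, fun m hm => le_antisymm (I.2 hm) fun u hu => ?_⟩
  obtain ⟨d, hd⟩ := hex u
  refine mem_of_leadingCoeff_le h hswap (I.2 hm) (fun n => ?_) d u hu hd
  rcases lt_or_ge n N with hn | hn
  · have hKn : K n ≤ max N M :=
      (hM (Finset.mem_coe.2 (Finset.mem_image_of_mem K (Finset.mem_range.2 hn)))).trans
        (le_max_right _ _)
    exact ((hK n m (hKn.trans hm)).symm.trans (hK n _ hKn)).le
  · calc L (I m) n ≤ L (I (max n m)) (max n m) :=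
          leadingCoeff_mono h hswap (I.2 (le_max_right _ _)) (le_max_left _ _)
      _ = L (I N) N := (hN _ (hn.trans (le_max_left _ _))).symm
      _ ≤ L (I (max N M)) n := leadingCoeff_mono h hswap (I.2 (le_max_left _ _)) hn

include h hswap in
theorem isNoetherianRing_op_of_closure [IsNoetherianRing Rᵐᵒᵖ]
    (hgen : Subring.closure (Set.range j ∪ {x}) = ⊤) : IsNoetherianRing Sᵐᵒᵖ := by
  refine isNoetherianRing_of_closure (j := j.op) (x := MulOpposite.op x) ?_ ?_ ?_
  · intro r
    obtain ⟨a, b, hab⟩ := hswap r.unop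
    exact ⟨.op a, .op b, by simpa [← MulOpposite.op_mul, ← MulOpposite.op_add] using hab⟩
  · intro r
    obtain ⟨a, b, hab⟩ := h r.unop
    exact ⟨.op a, .op b, by simpa [← MulOpposite.op_mul, ← MulOpposite.op_add] using hab⟩
  · have := Subring.op_closure (Set.range j ∪ {x})
    rw [hgen, Subring.op_top] at this
    rw [this]
    congr 1
    ext s
    obtain ⟨s, rfl⟩ := MulOpposite.op_surjective s
    simp only [Set.mem_union, Set.mem_range, Set.mem_singleton_iff, Set.mem_preimage,
      MulOpposite.unop_op, MulOpposite.op_inj]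
    refine or_congr_left ⟨fun ⟨y, hy⟩ => ⟨y.unop, ?_⟩, fun ⟨y, hy⟩ => ⟨.op y, ?_⟩⟩
    · exact MulOpposite.op_injective hy
    · exact congrArg MulOpposite.op hy

end OreNoetherian
/-- A ring `U` that is generated over a noetherian commutative ring `A` by elements `E` and `F`
normalizing `A`, with `E * F - F * E` in `A`, is left and right noetherian. -/
theorem OreNoetherian.isNoetherianRing_of_commutator {A U : Type*} [CommRing A]
    [IsNoetherianRing A] [Ring U] (j : A →+* U) (σ : A ≃+* A) {E F : U} {f : A}
    (hE : ∀ a, E * j a = j (σ a) * E) (hF : ∀ a, j a * F = F * j (σ a))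
    (hEF : E * F - F * E = j f) (hgen : Subring.closure (Set.range j ∪ {E, F}) = ⊤) :
    IsNoetherianRing U ∧ IsNoetherianRing Uᵐᵒᵖ := by
  have hE' : ∀ a, j a * E = E * j (σ.symm a) := fun a => by rw [hE, σ.apply_symm_apply]
  have hF' : ∀ a, F * j a = j (σ.symm a) * F := fun a => by rw [hF, σ.apply_symm_apply]
  have hEF' : E * F = F * E + j f := by rw [← hEF]; abel
  have hFE' : F * E = E * F - j f := by rw [← hEF]; abel
  have : IsNoetherianRing Aᵐᵒᵖ := isNoetherianRing_of_ringEquiv A (RingEquiv.toOpposite A)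
  let B : Subring U := Subring.closure (Set.range j ∪ {E})
  have hjB : ∀ a, j a ∈ B := fun a => Subring.subset_closure (Or.inl ⟨a, rfl⟩)
  have hEB : E ∈ B := Subring.subset_closure (Or.inr rfl)
  let jB : A →+* B := j.codRestrict B hjB
  let EB : B := ⟨E, hEB⟩
  have hB1 : ∀ r, ∃ a b, jB r * EB = EB * jB a + jB b := fun r =>
    ⟨σ.symm r, 0, Subtype.ext (by simpa [jB, EB] using hE' r)⟩
  have hB2 : ∀ r, ∃ a b, EB * jB r = jB a * EB + jB b := fun r =>
    ⟨σ r, 0, Subtype.ext (by simpa [jB, EB] using hE r)⟩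
  have hBgen : Subring.closure (Set.range jB ∪ {EB}) = ⊤ := by
    have hmap : (Subring.closure (Set.range jB ∪ {EB})).map B.subtype = B := by
      rw [RingHom.map_closure, Set.image_union, ← Set.range_comp, Set.image_singleton]
      rfl
    refine eq_top_iff.2 fun b _ => ?_
    obtain ⟨b', hb', h⟩ := hmap.ge b.2
    rwa [← Subtype.ext h]
  have : IsNoetherianRing B := isNoetherianRing_of_closure hB1 hB2 hBgen
  have : IsNoetherianRing Bᵐᵒᵖ := isNoetherianRing_op_of_closure hB1 hB2 hBgen
  have h1 : ∀ r : B, ∃ a b : B, B.subtype r * F = F * B.subtype a + B.subtype b := by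
    rintro ⟨r, hr⟩
    induction hr using Subring.closure_induction with
    | mem s hs =>
      rcases hs with ⟨a, rfl⟩ | rfl
      · exact ⟨⟨_, hjB (σ a)⟩, 0, by simpa using hF a⟩
      · exact ⟨⟨_, hEB⟩, ⟨_, hjB f⟩, hEF'⟩
    | zero => exact ⟨0, 0, by simp⟩
    | one => exact ⟨1, 0, by simp⟩
    | add s s' _ _ h h' =>
      obtain ⟨a, b, h⟩ := h
      obtain ⟨a', b', h'⟩ := h'
      refine ⟨a + a', b + b', ?_⟩
      simp only [Subring.subtype_apply, Subring.coe_add] at h h' ⊢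
      rw [add_mul, h, h']; noncomm_ring
    | neg s _ h =>
      obtain ⟨a, b, h⟩ := h
      refine ⟨-a, -b, ?_⟩
      simp only [Subring.subtype_apply, Subring.coe_neg] at h ⊢
      rw [neg_mul, h]; noncomm_ring
    | mul s s' hs _ h h' =>
      obtain ⟨a, b, h⟩ := h
      obtain ⟨a', b', h'⟩ := h'
      refine ⟨a * a', b * a' + ⟨s, hs⟩ * b', ?_⟩
      simp only [Subring.subtype_apply, Subring.coe_add, Subring.coe_mul] at h h' ⊢
      rw [mul_assoc, h', mul_add, ← mul_assoc s, h]; noncomm_ring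
  have h2 : ∀ r : B, ∃ a b : B, F * B.subtype r = B.subtype a * F + B.subtype b := by
    rintro ⟨r, hr⟩
    induction hr using Subring.closure_induction with
    | mem s hs =>
      rcases hs with ⟨a, rfl⟩ | rfl
      · exact ⟨⟨_, hjB (σ.symm a)⟩, 0, by simpa using hF' a⟩
      · exact ⟨⟨_, hEB⟩, -⟨_, hjB f⟩, by simpa [sub_eq_add_neg] using hFE'⟩
    | zero => exact ⟨0, 0, by simp⟩
    | one => exact ⟨1, 0, by simp⟩
    | add s s' _ _ h h' =>
      obtain ⟨a, b, h⟩ := h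
      obtain ⟨a', b', h'⟩ := h'
      refine ⟨a + a', b + b', ?_⟩
      simp only [Subring.subtype_apply, Subring.coe_add] at h h' ⊢
      rw [mul_add, h, h']; noncomm_ring
    | neg s _ h =>
      obtain ⟨a, b, h⟩ := h
      refine ⟨-a, -b, ?_⟩
      simp only [Subring.subtype_apply, Subring.coe_neg] at h ⊢
      rw [mul_neg, h]; noncomm_ring
    | mul s s' _ hs' h h' =>
      obtain ⟨a, b, h⟩ := h
      obtain ⟨a', b', h'⟩ := h'
      refine ⟨a * a', a * b' + b * ⟨s', hs'⟩, ?_⟩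
      simp only [Subring.subtype_apply, Subring.coe_add, Subring.coe_mul] at h h' ⊢
      rw [← mul_assoc, h, add_mul, mul_assoc, h']; noncomm_ring
  have hgen' : Subring.closure (Set.range B.subtype ∪ {F}) = ⊤ := by
    rw [eq_top_iff, ← hgen, Subring.closure_le]
    rintro _ (⟨a, rfl⟩ | rfl | rfl)
    · exact Subring.subset_closure (Or.inl ⟨⟨_, hjB a⟩, rfl⟩)
    · exact Subring.subset_closure (Or.inl ⟨⟨_, hEB⟩, rfl⟩)
    · exact Subring.subset_closure (Or.inr rfl)
  exact ⟨isNoetherianRing_of_closure h1 h2 hgen', isNoetherianRing_op_of_closure h1 h2 hgen'⟩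

namespace SkewMonoidAlgebra

variable {k G : Type*} [Ring k] [Monoid G] [MulSemiringAction G k]

theorem coeff_mul_mul_of_uniqueMul {f g : SkewMonoidAlgebra k G} {a b : G}
    (h : UniqueMul f.support g.support a b) :
    (f * g).coeff (a * b) = f.coeff a * a • g.coeff b := by
  classical
  rw [mul_def]
  simp only [sum_def, Finsupp.sum, support_coeff]
  rw [← Finset.sum_product' (f := fun x y => single (x * y) (f.coeff x * x • g.coeff y)),
    ← coeffAddEquiv_apply, _root_.map_sum, Finsupp.finsetSum_apply]
  simp only [coeffAddEquiv_apply, coeff_single_apply]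
  refine (Finset.sum_eq_single (a, b) ?_ ?_).trans (if_pos rfl)
  · rintro ⟨c, d⟩ hcd hne
    rw [Finset.mem_product] at hcd
    exact if_neg fun he => hne <| Prod.ext_iff.2 (h hcd.1 hcd.2 he)
  · intro hab
    rw [if_pos rfl]
    by_cases ha : f.coeff a = 0
    · simp [ha]
    · have hb : g.coeff b = 0 := by
        by_contra hb
        exact hab (Finset.mem_product.2 ⟨mem_support_iff.2 ha, mem_support_iff.2 hb⟩)
      simp [hb]

theorem noZeroDivisors_of_uniqueProds {G : Type*} [Group G] [MulSemiringAction G k]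
    [NoZeroDivisors k] [UniqueProds G] : NoZeroDivisors (SkewMonoidAlgebra k G) where
  eq_zero_or_eq_zero_of_mul_eq_zero {f g} hfg := by
    by_contra! hne
    have hf : f.support.Nonempty :=
      Finset.nonempty_iff_ne_empty.2 fun h => hne.1 (support_eq_empty.1 h)
    have hg : g.support.Nonempty :=
      Finset.nonempty_iff_ne_empty.2 fun h => hne.2 (support_eq_empty.1 h)
    obtain ⟨a, ha, b, hb, h⟩ := UniqueProds.uniqueMul_of_nonempty hf hg
    have key := coeff_mul_mul_of_uniqueMul h
    rw [hfg, coeff_zero, Finsupp.zero_apply] at key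
    refine mul_ne_zero (mem_support_iff.1 ha) ?_ key.symm
    exact (smul_ne_zero_iff_ne a).2 (mem_support_iff.1 hb)

end SkewMonoidAlgebra

namespace GeneralizedWeyl

/-- The element `E ^ n` for `n ≥ 0` and `F ^ (-n)` for `n < 0`. -/
def basisPow {U : Type*} [Monoid U] (E F : U) : ℤ → U
  | .ofNat n => E ^ n
  | .negSucc n => F ^ (n + 1)

variable {D U : Type*} [CommRing D] [Ring U] {E F : U} {ι : D →+* U} {t : D}

theorem exists_E_mul_basisPow {σt : D} (hEF : E * F = ι σt) (n : ℤ) :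
    ∃ d, E * basisPow E F n = ι d * basisPow E F (n + 1) := by
  rcases n with n | n
  · exact ⟨1, by rw [map_one, one_mul]; exact (pow_succ' E n).symm⟩
  · refine ⟨σt, ?_⟩
    rcases n with _ | n
    · simp [basisPow, hEF]
    · change E * F ^ (n + 1 + 1) = ι σt * F ^ (n + 1)
      rw [pow_succ', ← mul_assoc, hEF]

theorem exists_F_mul_basisPow (hFE : F * E = ι t) (n : ℤ) :
    ∃ d, F * basisPow E F n = ι d * basisPow E F (n - 1) := by
  rcases n with n | n
  · rcases n with _ | n
    · refine ⟨1, ?_⟩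
      change F * E ^ 0 = ι 1 * F ^ (0 + 1)
      simp
    · refine ⟨t, ?_⟩
      have e : Int.ofNat (n + 1) - 1 = Int.ofNat n := by simp
      rw [e]
      change F * E ^ (n + 1) = ι t * E ^ n
      rw [pow_succ', ← mul_assoc, hFE]
  · exact ⟨1, by rw [map_one, one_mul]; exact (pow_succ' F (n + 1)).symm⟩

variable (E F ι) in
/-- The map sending coefficients `c n` to `∑ ι (c n) * basisPow E F n`. -/
noncomputable def ofCoeffs : (ℤ →₀ D) →+ U :=
  Finsupp.liftAddHom fun n => (AddMonoidHom.mulRight (basisPow E F n)).comp ι.toAddMonoidHom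

@[simp]
theorem ofCoeffs_single (n : ℤ) (d : D) :
    ofCoeffs E F ι (Finsupp.single n d) = ι d * basisPow E F n := by
  simp [ofCoeffs]

theorem mul_ofCoeffs_mem {g : U}
    (hg : ∀ n d, ∃ m d', g * (ι d * basisPow E F n) = ι d' * basisPow E F m)
    {w : U} (hw : w ∈ (ofCoeffs E F ι).range) : g * w ∈ (ofCoeffs E F ι).range := by
  obtain ⟨c, rfl⟩ := hw
  induction c using Finsupp.induction_linear with
  | zero => simp [zero_mem]
  | add a b ha hb => rw [map_add, mul_add]; exact add_mem ha hb
  | single n d =>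
    obtain ⟨m, d', h⟩ := hg n d
    exact ⟨Finsupp.single m d', by rw [ofCoeffs_single, ofCoeffs_single, h]⟩

theorem ofCoeffs_surjective (τ : D ≃+* D)
    (hE : ∀ d, E * ι d = ι (τ d) * E) (hF : ∀ d, ι d * F = F * ι (τ d))
    (hFE : F * E = ι t) (hEF : E * F = ι (τ t))
    (hgen : Subring.closure (Set.range ι ∪ {E, F}) = ⊤) :
    Function.Surjective (ofCoeffs E F ι) := by
  intro u
  refine AddSubgroup.mem_of_closure_eq_top hgen (ofCoeffs E F ι).range
    ⟨Finsupp.single 0 1, by simp [basisPow]⟩ ?_ u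
  rintro _ (⟨d, rfl⟩ | rfl | rfl) w hw <;> refine mul_ofCoeffs_mem (fun n d' => ?_) hw
  · exact ⟨n, d * d', by rw [map_mul, mul_assoc]⟩
  · obtain ⟨a, ha⟩ := exists_E_mul_basisPow hEF n
    exact ⟨n + 1, τ d' * a, by rw [← mul_assoc, hE, mul_assoc, ha, map_mul, mul_assoc]⟩
  · obtain ⟨a, ha⟩ := exists_F_mul_basisPow hFE n
    refine ⟨n - 1, τ.symm d' * a, ?_⟩
    have := hF (τ.symm d')
    rw [RingEquiv.apply_symm_apply] at this
    rw [← mul_assoc, ← this, mul_assoc, ha, map_mul, mul_assoc]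

open Multiplicative in
theorem exists_map_basisPow [IsDomain D] [MulSemiringAction (Multiplicative ℤ) D]
    (ht : t ≠ 0) (φ : U →+* SkewMonoidAlgebra D (Multiplicative ℤ))
    (hφE : φ E = .single (ofAdd 1) 1) (hφF : φ F = .single (ofAdd (-1)) t) (n : ℤ) :
    ∃ g ≠ 0, φ (basisPow E F n) = .single (ofAdd n) g := by
  have hF : ∀ n : ℕ, ∃ g ≠ 0, φ (F ^ n) = .single (ofAdd (-n : ℤ)) g := by
    intro n
    induction n with
    | zero => exact ⟨1, one_ne_zero, by simp⟩
    | succ n ih =>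
      obtain ⟨g, hg, h⟩ := ih
      refine ⟨t * ofAdd (-1 : ℤ) • g, mul_ne_zero ht ((smul_ne_zero_iff_ne _).2 hg), ?_⟩
      rw [pow_succ', map_mul, h, hφF, SkewMonoidAlgebra.single_mul_single, ← ofAdd_add]
      congr 2
      push_cast; ring
  rcases n with n | n
  · refine ⟨1, one_ne_zero, ?_⟩
    change φ (E ^ n) = .single (ofAdd (n : ℤ)) 1
    induction n with
    | zero => simp
    | succ n ih =>
      rw [pow_succ', map_mul, ih, hφE, SkewMonoidAlgebra.single_mul_single, ← ofAdd_add, smul_one,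
        mul_one]
      congr 2
      push_cast; ring
  · exact hF (n + 1)

open Multiplicative in
theorem isDomain [IsDomain D] [MulSemiringAction (Multiplicative ℤ) D] (τ : D ≃+* D)
    (hE : ∀ d, E * ι d = ι (τ d) * E) (hF : ∀ d, ι d * F = F * ι (τ d))
    (hFE : F * E = ι t) (hEF : E * F = ι (τ t))
    (hgen : Subring.closure (Set.range ι ∪ {E, F}) = ⊤)
    (ht : t ≠ 0) (φ : U →+* SkewMonoidAlgebra D (Multiplicative ℤ))
    (hφ : ∀ d, φ (ι d) = .single 1 d)
    (hφE : φ E = .single (ofAdd 1) 1) (hφF : φ F = .single (ofAdd (-1)) t) : IsDomain U := by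
  choose g hg hφg using exists_map_basisPow ht φ hφE hφF
  have hcoeff : ∀ c n, (φ (ofCoeffs E F ι c)).coeff (ofAdd n) = c n * g n := by
    classical
    intro c n
    induction c using Finsupp.induction_linear with
    | zero => simp
    | add a b ha hb => simp [ha, hb, add_mul]
    | single m d =>
      rw [ofCoeffs_single, map_mul, hφ, hφg, SkewMonoidAlgebra.single_mul_single, one_mul,
        one_smul, SkewMonoidAlgebra.coeff_single_apply, Finsupp.single_apply]
      by_cases h : m = n <;> simp [h]
  have hinj : Function.Injective φ := by
    rw [injective_iff_map_eq_zero]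
    intro u hu
    obtain ⟨c, rfl⟩ := ofCoeffs_surjective τ hE hF hFE hEF hgen u
    have hc : c = 0 := by
      ext n
      have := hcoeff c n
      rw [hu, SkewMonoidAlgebra.coeff_zero, Finsupp.zero_apply] at this
      exact (mul_eq_zero.1 this.symm).resolve_right (hg n)
    rw [hc, map_zero]
  have := SkewMonoidAlgebra.noZeroDivisors_of_uniqueProds (k := D) (G := Multiplicative ℤ)
  have : IsDomain (SkewMonoidAlgebra D (Multiplicative ℤ)) := NoZeroDivisors.to_isDomain _
  exact hinj.isDomain φ

end GeneralizedWeyl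

/-- The ring of Laurent polynomials in two variables. -/
abbrev LaurentKH : Type := AddMonoidAlgebra ℂ (ℤ × ℤ)

namespace LaurentKH

open Multiplicative AddMonoidAlgebra

section Eval

variable {U : Type*} [Ring U] [Algebra ℂ U]

/-- Evaluation of Laurent polynomials at a pair of commuting units. -/
noncomputable def eval (k h : Uˣ) (hkh : Commute k h) : LaurentKH →ₐ[ℂ] U :=
  AddMonoidAlgebra.lift ℂ U (ℤ × ℤ) <| (Units.coeHom U).comp
    { toFun := fun m => k ^ (toAdd m).1 * h ^ (toAdd m).2
      map_one' := by simp
      map_mul' := fun m n => by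
        simp only [toAdd_mul, Prod.fst_add, Prod.snd_add, zpow_add]
        exact Commute.mul_mul_mul_comm (hkh.zpow_zpow _ _) _ _ }

theorem eval_single (k h : Uˣ) (hkh : Commute k h) (m : ℤ × ℤ) (c : ℂ) :
    eval k h hkh (single m c) = c • ((k ^ m.1 * h ^ m.2 : Uˣ) : U) := by
  simp [eval]

/-- The automorphism scaling the first variable by `v⁻¹` and the second by `v`. -/
noncomputable def scaleHom (v : ℂˣ) : LaurentKH →ₐ[ℂ] LaurentKH :=
  AddMonoidAlgebra.lift ℂ LaurentKH (ℤ × ℤ)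
    { toFun := fun m => single (toAdd m) ((v ^ ((toAdd m).2 - (toAdd m).1) : ℂˣ) : ℂ)
      map_one' := by simp [AddMonoidAlgebra.one_def]
      map_mul' := fun m n => by
        rw [single_mul_single, ← Units.val_mul, ← zpow_add]
        congr 3
        simp only [toAdd_mul, Prod.fst_add, Prod.snd_add]
        ring }

theorem scaleHom_single (v : ℂˣ) (m : ℤ × ℤ) (c : ℂ) :
    scaleHom v (single m c) = single m (c * (v ^ (m.2 - m.1) : ℂˣ)) := by
  simp [scaleHom]

theorem scaleHom_inv_apply (v : ℂˣ) (a : LaurentKH) : scaleHom v⁻¹ (scaleHom v a) = a := by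
  induction a using AddMonoidAlgebra.induction_linear with
  | zero => simp
  | add a b ha hb => rw [map_add, map_add, ha, hb]
  | single m c =>
    rw [scaleHom_single, scaleHom_single, mul_assoc, ← Units.val_mul, ← mul_zpow]
    simp

/-- `scaleHom` as an equivalence. -/
noncomputable def scale (v : ℂˣ) : LaurentKH ≃ₐ[ℂ] LaurentKH :=
  AlgEquiv.ofAlgHom (scaleHom v) (scaleHom v⁻¹)
    (AlgHom.ext fun a => by simpa using scaleHom_inv_apply v⁻¹ a)
    (AlgHom.ext fun a => scaleHom_inv_apply v a)

theorem semiconjBy_eval {k h : Uˣ} (hkh : Commute k h) (v : ℂˣ) {x : U}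
    (hk : x * k = ((v⁻¹ : ℂˣ) : ℂ) • (k * x : U)) (hh : x * h = (v : ℂ) • (h * x : U))
    (a : LaurentKH) :
    SemiconjBy x (eval k h hkh a) (eval k h hkh (scaleHom v a)) := by
  have hpow : ∀ (w : ℂˣ) (g : Uˣ) (n : ℤ), x * g = (w : ℂ) • (g * x : U) →
      x * ((g ^ n : Uˣ) : U) = ((w ^ n : ℂˣ) : ℂ) • (((g ^ n : Uˣ) : U) * x) := by
    intro w g n hg
    let c : ℂˣ →* Uˣ := Units.map (algebraMap ℂ U).toMonoidHom
    have hc : ∀ w : ℂˣ, ((c w : Uˣ) : U) = algebraMap ℂ U w := fun _ => rfl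
    have hcomm : Commute (c w) g := Units.ext (Algebra.commutes _ _)
    have h1 : SemiconjBy x g ((c w * g : Uˣ) : U) := by
      rw [SemiconjBy, hg, Units.val_mul, hc, Algebra.smul_def, mul_assoc]
    have h2 := h1.units_zpow_right n
    rw [hcomm.mul_zpow, ← map_zpow, SemiconjBy, Units.val_mul, hc, mul_assoc,
      ← Algebra.smul_def] at h2
    exact h2
  induction a using AddMonoidAlgebra.induction_linear with
  | zero => simp
  | add a b ha hb => rw [map_add, map_add, map_add]; exact ha.add_right hb
  | single m c =>
    rw [SemiconjBy, scaleHom_single, eval_single, eval_single, Units.val_mul, mul_smul_comm,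
      ← mul_assoc, hpow _ _ _ hk, smul_mul_assoc, mul_assoc, hpow _ _ _ hh, smul_mul_assoc,
      mul_smul_comm, smul_smul, smul_smul, mul_assoc, mul_assoc]
    congr 2
    rw [← Units.val_mul, inv_zpow', ← zpow_add, sub_eq_add_neg, add_comm]

end Eval

end LaurentKH

theorem map_evalKH {T : Type*} [Semiring T] [Algebra ℂ T] (φ : FA →ₐ[ℂ] T)
    (ψ : LaurentKH →ₐ[ℂ] T) (hK : φ gK = ψ (.single (1, 0) 1))
    (hKi : φ gKi = ψ (.single (-1, 0) 1)) (hH : φ gH = ψ (.single (0, 1) 1))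
    (hHi : φ gHi = ψ (.single (0, -1) 1)) (P : (ℤ × ℤ) →₀ ℂ) :
    φ (evalKH P) = ψ (P.sum AddMonoidAlgebra.single) := by
  rw [evalKH, map_finsuppSum, map_finsuppSum]
  refine Finsupp.sum_congr fun m _ => ?_
  have hzK : φ (zK m.1) = ψ (.single (m.1, 0) 1) := by
    rw [zK, map_mul, map_pow, map_pow, hK, hKi, ← map_pow, ← map_pow, ← map_mul,
      AddMonoidAlgebra.single_pow, AddMonoidAlgebra.single_pow, AddMonoidAlgebra.single_mul_single]
    congr 2
    · ext
      · simp; omega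
      · simp
    · simp
  have hzH : φ (zH m.2) = ψ (.single (0, m.2) 1) := by
    rw [zH, map_mul, map_pow, map_pow, hH, hHi, ← map_pow, ← map_pow, ← map_mul,
      AddMonoidAlgebra.single_pow, AddMonoidAlgebra.single_pow, AddMonoidAlgebra.single_mul_single]
    congr 2
    · ext
      · simp
      · simp; omega
    · simp
  rw [map_smul, map_mul, hzK, hzH, ← map_mul, AddMonoidAlgebra.single_mul_single, ← map_smul]
  simp

namespace GeneralizedWeyl

open Multiplicative Polynomial

theorem semiconjBy_of_C_of_X {A U : Type*} [CommRing A] [Ring U] {ι : A[X] →+* U}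
    (τ : A[X] →+* A[X]) {x : U}
    (hC : ∀ a, SemiconjBy x (ι (C a)) (ι (τ (C a)))) (hX : SemiconjBy x (ι X) (ι (τ X)))
    (d : A[X]) : SemiconjBy x (ι d) (ι (τ d)) := by
  induction d using Polynomial.induction_on' with
  | add p q hp hq => simpa only [map_add] using hp.add_right hq
  | monomial n a =>
    rw [← C_mul_X_pow_eq_monomial]
    simpa only [map_mul, map_pow] using (hC a).mul_right (hX.pow_right n)

section Polynomial

variable {A : Type*} [CommRing A] [Algebra ℂ A]

/-- The automorphism of `A[X]` extending `σ` and sending `X` to `X + f`. -/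
noncomputable def shift (σ : A ≃ₐ[ℂ] A) (f : A) : A[X] ≃+* A[X] :=
  (Polynomial.mapEquiv σ.toRingEquiv).trans (algEquivAevalXAddC f).toRingEquiv

@[simp]
theorem shift_C (σ : A ≃ₐ[ℂ] A) (f a : A) : shift σ f (C a) = C (σ a) := by
  simp [shift]

@[simp]
theorem shift_X (σ : A ≃ₐ[ℂ] A) (f : A) : shift σ f X = X + C f := by
  simp [shift]

/-- The action of `ℤ` on `A[X]` through the powers of `shift σ f`. -/
noncomputable abbrev shiftAction (σ : A ≃ₐ[ℂ] A) (f : A) :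
    MulSemiringAction (Multiplicative ℤ) A[X] :=
  MulSemiringAction.compHom A[X]
    (zpowersHom (RingAut A[X]) (shift σ f) : Multiplicative ℤ →* RingAut A[X])

end Polynomial

section SkewLaurent

variable {D : Type*} [CommRing D] [Algebra ℂ D] [MulSemiringAction (Multiplicative ℤ) D]

/-- Skew Laurent polynomials over `D` form an algebra when the action fixes the scalars. -/
noncomputable abbrev skewLaurentAlgebra
    (hD : ∀ (g : Multiplicative ℤ) (c : ℂ), g • algebraMap ℂ D c = algebraMap ℂ D c) :
    Algebra ℂ (SkewMonoidAlgebra D (Multiplicative ℤ)) :=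
  RingHom.toAlgebra'
    { toFun := fun c => .single 1 (algebraMap ℂ D c)
      map_one' := by rw [map_one, SkewMonoidAlgebra.one_def]
      map_mul' := fun a b => by simp [SkewMonoidAlgebra.single_mul_single]
      map_zero' := by simp
      map_add' := fun a b => by rw [map_add, SkewMonoidAlgebra.single_add] }
    (fun c x => by
      change SkewMonoidAlgebra.single 1 (algebraMap ℂ D c) * x =
        x * SkewMonoidAlgebra.single 1 (algebraMap ℂ D c)
      induction x using SkewMonoidAlgebra.induction_on with
      | zero => simp
      | single g a =>
        rw [SkewMonoidAlgebra.single_mul_single, SkewMonoidAlgebra.single_mul_single, hD,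
          one_smul, one_mul, mul_one, mul_comm]
      | add f g hf hg => rw [mul_add, add_mul, hf, hg])

end SkewLaurent

end GeneralizedWeyl

namespace Uq

open GeneralizedWeyl Multiplicative Polynomial

variable {q : ℂ} {r : FA}

theorem mk_rel {a b : FA} (h : URel q r a b) :
    RingQuot.mkAlgHom ℂ (URel q r) a = RingQuot.mkAlgHom ℂ (URel q r) b :=
  RingQuot.mkAlgHom_rel ℂ h

variable (q r) in
/-- `K` as a unit. -/
def unitK : (Uq q r)ˣ where
  val := uK q r
  inv := uKi q r
  val_inv := by simpa [uK, uKi] using mk_rel (URel.KKi (q := q) (r := r))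
  inv_val := by simpa [uK, uKi] using mk_rel (URel.KiK (q := q) (r := r))

variable (q r) in
/-- `H` as a unit. -/
def unitH : (Uq q r)ˣ where
  val := uH q r
  inv := uHi q r
  val_inv := by simpa [uH, uHi] using mk_rel (URel.HHi (q := q) (r := r))
  inv_val := by simpa [uH, uHi] using mk_rel (URel.HiH (q := q) (r := r))

theorem commute_unitK_unitH : Commute (unitK q r) (unitH q r) :=
  Units.ext (by simpa [unitK, unitH, uK, uH] using mk_rel (URel.KH (q := q) (r := r)))

variable (q r) in
/-- Evaluation of Laurent polynomials at `K` and `H`. -/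
noncomputable def ofLaurent : LaurentKH →ₐ[ℂ] Uq q r :=
  LaurentKH.eval (unitK q r) (unitH q r) commute_unitK_unitH

theorem ofLaurent_K : ofLaurent q r (.single (1, 0) 1) = uK q r := by
  simp [ofLaurent, LaurentKH.eval_single, unitK]

theorem ofLaurent_Ki : ofLaurent q r (.single (-1, 0) 1) = uKi q r := by
  simp [ofLaurent, LaurentKH.eval_single, unitK]

theorem ofLaurent_H : ofLaurent q r (.single (0, 1) 1) = uH q r := by
  simp [ofLaurent, LaurentKH.eval_single, unitH]

theorem ofLaurent_Hi : ofLaurent q r (.single (0, -1) 1) = uHi q r := by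
  simp [ofLaurent, LaurentKH.eval_single, unitH]

theorem commutator_eq (P : (ℤ × ℤ) →₀ ℂ) :
    uE q (evalKH P) * uF q (evalKH P) - uF q (evalKH P) * uE q (evalKH P) =
      ofLaurent q (evalKH P) (P.sum AddMonoidAlgebra.single) := by
  rw [← map_evalKH (RingQuot.mkAlgHom ℂ (URel q (evalKH P))) _ ofLaurent_K.symm
    ofLaurent_Ki.symm ofLaurent_H.symm ofLaurent_Hi.symm P]
  simpa [uE, uF] using mk_rel (URel.EF (q := q) (r := evalKH P))

/-- The automorphism of the Laurent polynomials given by commuting past `E`. -/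
noncomputable abbrev twist (hq : q ≠ 0) : LaurentKH ≃ₐ[ℂ] LaurentKH :=
  LaurentKH.scale (Units.mk0 (q ^ 2) (pow_ne_zero 2 hq))

theorem E_mul_ofLaurent (hq : q ≠ 0) (a : LaurentKH) :
    uE q r * ofLaurent q r a = ofLaurent q r (twist hq a) * uE q r := by
  refine LaurentKH.semiconjBy_eval commute_unitK_unitH (Units.mk0 (q ^ 2) (pow_ne_zero 2 hq))
    ?_ ?_ a
  · have h := mk_rel (URel.KE (q := q) (r := r))
    rw [map_smul, map_mul, map_mul] at h
    change uE q r * uK q r = (q ^ 2)⁻¹ • (uK q r * uE q r)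
    rw [eq_inv_smul_iff₀ (pow_ne_zero 2 hq)]
    exact h.symm
  · have h := mk_rel (URel.HE (q := q) (r := r))
    rw [map_smul, map_mul, map_mul] at h
    change uE q r * uH q r = q ^ 2 • (uH q r * uE q r)
    rw [← inv_smul_eq_iff₀ (pow_ne_zero 2 hq)]
    exact h.symm

theorem ofLaurent_mul_F (hq : q ≠ 0) (a : LaurentKH) :
    ofLaurent q r a * uF q r = uF q r * ofLaurent q r (twist hq a) := by
  have key := LaurentKH.semiconjBy_eval (x := uF q r) (commute_unitK_unitH (q := q) (r := r))
    (Units.mk0 (q ^ 2) (pow_ne_zero 2 hq))⁻¹ ?_ ?_ (twist hq a)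
  · have h : LaurentKH.scaleHom (Units.mk0 (q ^ 2) (pow_ne_zero 2 hq))⁻¹ (twist hq a) = a :=
      LaurentKH.scaleHom_inv_apply _ a
    rw [h] at key
    exact key.symm
  · have h := mk_rel (URel.KF (q := q) (r := r))
    rw [map_smul, map_mul, map_mul] at h
    rw [inv_inv]
    change uF q r * uK q r = q ^ 2 • (uK q r * uF q r)
    rw [← inv_smul_eq_iff₀ (pow_ne_zero 2 hq)]
    exact h.symm
  · have h := mk_rel (URel.HF (q := q) (r := r))
    rw [map_smul, map_mul, map_mul] at h
    change uF q r * uH q r = (q ^ 2)⁻¹ • (uH q r * uF q r)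
    rw [eq_inv_smul_iff₀ (pow_ne_zero 2 hq)]
    exact h.symm

theorem closure_eq_top :
    Subring.closure (Set.range (ofLaurent q r : LaurentKH →+* Uq q r) ∪ {uE q r, uF q r}) = ⊤ := by
  refine eq_top_iff.2 fun u _ => ?_
  obtain ⟨a, rfl⟩ := RingQuot.mkAlgHom_surjective ℂ (URel q r) u
  have hL : ∀ a, ofLaurent q r a ∈
      Subring.closure (Set.range (ofLaurent q r : LaurentKH →+* Uq q r) ∪ {uE q r, uF q r}) :=
    fun a => Subring.subset_closure (Or.inl ⟨a, rfl⟩)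
  induction a using FreeAlgebra.induction with
  | grade0 c =>
    rw [AlgHom.commutes, ← (ofLaurent q r).commutes]
    exact hL _
  | grade1 g =>
    cases g
    · exact Subring.subset_closure (Or.inr (Or.inl rfl))
    · exact Subring.subset_closure (Or.inr (Or.inr rfl))
    · have h := hL (.single (1, 0) 1)
      rw [ofLaurent_K] at h
      exact h
    · have h := hL (.single (-1, 0) 1)
      rw [ofLaurent_Ki] at h
      exact h
    · have h := hL (.single (0, 1) 1)
      rw [ofLaurent_H] at h
      exact h
    · have h := hL (.single (0, -1) 1)
      rw [ofLaurent_Hi] at h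
      exact h
  | mul a b ha hb => rw [map_mul]; exact mul_mem (ha trivial) (hb trivial)
  | add a b ha hb => rw [map_add]; exact add_mem (ha trivial) (hb trivial)

theorem isNoetherianRing (hq : q ≠ 0) (P : (ℤ × ℤ) →₀ ℂ) :
    IsNoetherianRing (Uq q (evalKH P)) ∧ IsNoetherianRing (Uq q (evalKH P))ᵐᵒᵖ := by
  have : IsNoetherianRing LaurentKH := Algebra.FiniteType.isNoetherianRing ℂ LaurentKH
  exact OreNoetherian.isNoetherianRing_of_commutator
    (ofLaurent q (evalKH P) : LaurentKH →+* Uq q (evalKH P)) (twist hq).toRingEquiv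
    (E_mul_ofLaurent hq) (ofLaurent_mul_F hq) (commutator_eq P) closure_eq_top

/-- The embedding of `U_q(f(K,H))` into skew Laurent polynomials over `ℂ[K^{±1}, H^{±1}][X]`,
where `X` stands for `F * E`. -/
theorem exists_skewLaurent_hom (hq : q ≠ 0) (P : (ℤ × ℤ) →₀ ℂ) :
    letI := shiftAction (twist hq) (P.sum AddMonoidAlgebra.single)
    ∃ φ : Uq q (evalKH P) →+* SkewMonoidAlgebra LaurentKH[X] (Multiplicative ℤ),
      (∀ a, φ (ofLaurent q (evalKH P) a) = .single 1 (C a)) ∧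
      φ (uE q (evalKH P)) = .single (ofAdd 1) 1 ∧
      φ (uF q (evalKH P)) = .single (ofAdd (-1)) X := by
  set f : LaurentKH := P.sum AddMonoidAlgebra.single with hf
  let τ := shift (twist hq) f
  let := shiftAction (twist hq) f
  have hact : ∀ (n : ℤ) (d : LaurentKH[X]), ofAdd n • d = (τ ^ n : RingAut LaurentKH[X]) d :=
    fun _ _ => rfl
  have hact1 : ∀ d : LaurentKH[X], ofAdd (1 : ℤ) • d = τ d := fun d => by rw [hact, zpow_one]
  have hact2 : ∀ d : LaurentKH[X], ofAdd (-1 : ℤ) • τ d = d := fun d => by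
    rw [← hact1, smul_smul, ← ofAdd_add]; simp
  have hD : ∀ (g : Multiplicative ℤ) (c : ℂ),
      g • algebraMap ℂ LaurentKH[X] c = algebraMap ℂ LaurentKH[X] c := by
    intro g c
    have h1 : τ ∈ MulAction.stabilizer (RingAut LaurentKH[X]) (algebraMap ℂ LaurentKH[X] c) := by
      change shift (twist hq) f (C (algebraMap ℂ LaurentKH c)) = C (algebraMap ℂ LaurentKH c)
      rw [shift_C, AlgEquiv.commutes]
    exact zpow_mem h1 (toAdd g)
  let := skewLaurentAlgebra hD
  let T := SkewMonoidAlgebra LaurentKH[X] (Multiplicative ℤ)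
  let ψ : LaurentKH →ₐ[ℂ] T :=
    { toFun := fun a => .single 1 (C a)
      map_one' := by rw [C_1, SkewMonoidAlgebra.one_def]
      map_mul' := fun a b => by simp [T, SkewMonoidAlgebra.single_mul_single]
      map_zero' := by simp
      map_add' := fun a b => by rw [C_add, SkewMonoidAlgebra.single_add]
      commutes' := fun c => rfl }
  let e : T := .single (ofAdd 1) 1
  let w : T := .single (ofAdd (-1)) X
  have he : ∀ a, e * ψ a = ψ (twist hq a) * e := by
    intro a
    change SkewMonoidAlgebra.single _ _ * SkewMonoidAlgebra.single _ _ =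
      SkewMonoidAlgebra.single _ _ * SkewMonoidAlgebra.single _ _
    rw [SkewMonoidAlgebra.single_mul_single, SkewMonoidAlgebra.single_mul_single, hact1]
    simp [τ]
  have hw : ∀ a, ψ a * w = w * ψ (twist hq a) := by
    intro a
    change SkewMonoidAlgebra.single _ _ * SkewMonoidAlgebra.single _ _ =
      SkewMonoidAlgebra.single _ _ * SkewMonoidAlgebra.single _ _
    rw [SkewMonoidAlgebra.single_mul_single, SkewMonoidAlgebra.single_mul_single,
      ← shift_C _ f, hact2, one_smul, one_mul, mul_one, mul_comm]
  have hew : e * w - w * e = ψ f := by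
    change SkewMonoidAlgebra.single _ _ * SkewMonoidAlgebra.single _ _ -
      SkewMonoidAlgebra.single _ _ * SkewMonoidAlgebra.single _ _ = SkewMonoidAlgebra.single _ _
    rw [SkewMonoidAlgebra.single_mul_single, SkewMonoidAlgebra.single_mul_single, hact1,
      ← ofAdd_add, ← ofAdd_add, sub_eq_iff_eq_add]
    simp only [add_neg_cancel, ofAdd_zero, ← SkewMonoidAlgebra.single_add, τ,
      shift_X, smul_one, one_mul, mul_one, add_comm]
  have hscale : ∀ i j : ℤ, twist hq (.single (i, j) 1) =
      ((Units.mk0 (q ^ 2) (pow_ne_zero 2 hq) ^ (j - i) : ℂˣ) : ℂ) •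
        (.single (i, j) 1 : LaurentKH) := by
    intro i j
    rw [AddMonoidAlgebra.smul_single, smul_eq_mul, mul_one]
    exact (LaurentKH.scaleHom_single _ _ _).trans (by rw [one_mul])
  have hK : twist hq (.single (1, 0) 1) = (q ^ 2)⁻¹ • (.single (1, 0) 1 : LaurentKH) := by
    rw [hscale]; simp
  have hH : twist hq (.single (0, 1) 1) = q ^ 2 • (.single (0, 1) 1 : LaurentKH) := by
    rw [hscale]; simp
  have hq2 : q ^ 2 ≠ 0 := pow_ne_zero 2 hq
  let gen : Gen → T
    | .E => e
    | .F => w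
    | .K => ψ (.single (1, 0) 1)
    | .Kinv => ψ (.single (-1, 0) 1)
    | .H => ψ (.single (0, 1) 1)
    | .Hinv => ψ (.single (0, -1) 1)
  let Φ : FA →ₐ[ℂ] T := FreeAlgebra.lift ℂ gen
  have hΦ : ∀ g, Φ (FreeAlgebra.ι ℂ g) = gen g := fun g => FreeAlgebra.lift_ι_apply gen g
  have hrel : ∀ ⦃a b : FA⦄, URel q (evalKH P) a b → Φ a = Φ b := by
    intro a b h
    have hr : Φ (evalKH P) = ψ f := map_evalKH Φ ψ (hΦ _) (hΦ _) (hΦ _) (hΦ _) P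
    cases h <;>
      simp only [map_mul, map_smul, map_sub, map_one, gE, gF, gK, gKi, gH, gHi, hΦ, hr, gen]
    · rw [← map_mul, AddMonoidAlgebra.single_mul_single, ← map_one ψ, AddMonoidAlgebra.one_def]
      simp only [Prod.mk_add_mk, add_neg_cancel, mul_one, add_zero]
      rfl
    · rw [← map_mul, AddMonoidAlgebra.single_mul_single, ← map_one ψ, AddMonoidAlgebra.one_def]
      simp only [Prod.mk_add_mk, neg_add_cancel, mul_one, add_zero]
      rfl
    · rw [← map_mul, AddMonoidAlgebra.single_mul_single, ← map_one ψ, AddMonoidAlgebra.one_def]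
      simp only [Prod.mk_add_mk, add_neg_cancel, mul_one, add_zero]
      rfl
    · rw [← map_mul, AddMonoidAlgebra.single_mul_single, ← map_one ψ, AddMonoidAlgebra.one_def]
      simp only [Prod.mk_add_mk, neg_add_cancel, mul_one, add_zero]
      rfl
    · rw [← map_mul, ← map_mul, mul_comm]
    · rw [he, ← smul_mul_assoc, ← map_smul, hK, smul_inv_smul₀ hq2]
    · rw [hw, hK, map_smul, mul_smul_comm]
    · rw [he, ← smul_mul_assoc, ← map_smul, hH, inv_smul_smul₀ hq2]
    · rw [hw, hH, map_smul, mul_smul_comm]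
    · exact hew
  let φ : Uq q (evalKH P) →ₐ[ℂ] T := RingQuot.liftAlgHom ℂ ⟨Φ, hrel⟩
  have hφ : ∀ g, φ (RingQuot.mkAlgHom ℂ (URel q (evalKH P)) (FreeAlgebra.ι ℂ g)) = gen g :=
    fun g => (RingQuot.liftAlgHom_mkAlgHom_apply ℂ Φ hrel _).trans (hΦ g)
  refine ⟨φ, fun a => ?_, hφ .E, hφ .F⟩
  have h1 := map_evalKH (RingQuot.mkAlgHom ℂ (URel q (evalKH P))) _ ofLaurent_K.symm
    ofLaurent_Ki.symm ofLaurent_H.symm ofLaurent_Hi.symm a.coeff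
  have h2 := map_evalKH Φ ψ (hΦ _) (hΦ _) (hΦ _) (hΦ _) a.coeff
  rw [AddMonoidAlgebra.sum_coeff_single] at h1 h2
  rw [← h1]
  exact (RingQuot.liftAlgHom_mkAlgHom_apply ℂ Φ hrel _).trans h2

theorem isDomain (hq : q ≠ 0) (P : (ℤ × ℤ) →₀ ℂ) : IsDomain (Uq q (evalKH P)) := by
  set f : LaurentKH := P.sum AddMonoidAlgebra.single with hf
  set U := Uq q (evalKH P)
  set E := uE q (evalKH P)
  set F := uF q (evalKH P)
  let j : LaurentKH →+* U := ofLaurent q (evalKH P)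
  have hE : ∀ a, E * j a = j (twist hq a) * E := E_mul_ofLaurent hq
  have hF : ∀ a, j a * F = F * j (twist hq a) := ofLaurent_mul_F hq
  have hEF : E * F = F * E + j f := by rw [add_comm, ← sub_eq_iff_eq_add]; exact commutator_eq P
  let τ := shift (twist hq) f
  let ι : LaurentKH[X] →+* U := eval₂RingHom' j (F * E) fun a => by
    rw [Commute, SemiconjBy, ← mul_assoc, hF, mul_assoc, ← hE, mul_assoc]
  have hιC : ∀ a, ι (C a) = j a := fun a => eval₂_C _ _
  have hιX : ι X = F * E := eval₂_X _ _
  have hιE : ∀ d, SemiconjBy E (ι d) (ι (τ d)) := by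
    refine semiconjBy_of_C_of_X (τ : LaurentKH[X] →+* LaurentKH[X]) (fun a => ?_) ?_
    · simpa [SemiconjBy, τ, hιC] using hE a
    · rw [SemiconjBy, hιX, ← mul_assoc]
      simp [τ, hιX, hιC, hEF]
  have hιF : ∀ d, ι d * F = F * ι (τ d) := by
    intro d
    have key := semiconjBy_of_C_of_X (ι := ι) (x := F) (τ.symm : LaurentKH[X] →+* LaurentKH[X])
      (fun a => ?_) ?_ (τ d)
    · simpa using key.symm
    · have h : τ.symm (C a) = C ((twist hq).symm a) := by
        rw [RingEquiv.symm_apply_eq]; simp [τ]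
      have h' := hF ((twist hq).symm a)
      rw [AlgEquiv.apply_symm_apply] at h'
      simpa [SemiconjBy, h, hιC] using h'.symm
    · have h : τ.symm X = X - C ((twist hq).symm f) := by
        rw [RingEquiv.symm_apply_eq]; simp [τ]
      have h' := hF ((twist hq).symm f)
      rw [AlgEquiv.apply_symm_apply] at h'
      change F * ι X = ι (τ.symm X) * F
      rw [h, map_sub, hιX, hιC, sub_mul, h', mul_assoc F E F, hEF, mul_add, add_sub_cancel_right]
  let := shiftAction (twist hq) f
  obtain ⟨φ, hφ, hφE, hφF⟩ := exists_skewLaurent_hom hq P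
  refine GeneralizedWeyl.isDomain (ι := ι) (E := E) (F := F) (t := X) τ hιE hιF hιX.symm ?_ ?_
    X_ne_zero φ ?_ hφE hφF
  · simp [τ, hιX, hιC, hEF]
  · refine eq_top_iff.2 (closure_eq_top.ge.trans (Subring.closure_mono ?_))
    refine Set.union_subset_union_left _ ?_
    rintro _ ⟨a, rfl⟩
    exact ⟨C a, hιC a⟩
  · let s : LaurentKH[X] →+* SkewMonoidAlgebra LaurentKH[X] (Multiplicative ℤ) :=
      { toFun := fun d => .single 1 d
        map_one' := SkewMonoidAlgebra.one_def.symm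
        map_mul' := fun a b => by simp [SkewMonoidAlgebra.single_mul_single]
        map_zero' := by simp
        map_add' := fun a b => SkewMonoidAlgebra.single_add _ _ _ }
    have h : φ.comp ι = s := by
      refine Polynomial.ringHom_ext (fun a => ?_) ?_
      · exact (congrArg φ (hιC a)).trans (hφ a)
      · change φ (ι X) = .single 1 X
        rw [hιX, map_mul, hφF, hφE, SkewMonoidAlgebra.single_mul_single, smul_one, mul_one,
          ← ofAdd_add]
        simp
    exact RingHom.congr_fun h

end Uq

/-- The algebra `U_q(f(K,H))` is a left and right noetherian
integral domain. -/
theorem stmt1 (q : ℂ) (hq0 : q ≠ 0) (hq2 : q ^ 2 ≠ 1) (P : (ℤ × ℤ) →₀ ℂ) :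
    IsNoetherianRing (Uq q (evalKH P)) ∧
    IsNoetherianRing (Uq q (evalKH P))ᵐᵒᵖ ∧
    IsDomain (Uq q (evalKH P)) := by
  exact ⟨(Uq.isNoetherianRing hq0 P).1, (Uq.isNoetherianRing hq0 P).2, Uq.isDomain hq0 P⟩
end

section
/- Suppose α = (β^m − γ^m)/(q − q⁻¹) and (β/γ)^m = q^{2mn} for some integer n ≥ 0. Then the left U-module U/P_{1,n+1}, where P_{1,n+1} = U(EF − α) + U(K − β) + U(H − γ) + UE + UF^{n+1}, is a nonzero finite-dimensional irreducible (simple) representation of U. -/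
set_option synthInstance.maxHeartbeats 1000000
set_option maxHeartbeats 1000000

/-- The left ideal `P_{1,n+1} = U(EF - α) + U(K - β) + U(H - γ) + UE + UF^{n+1}`. -/
noncomputable def P1n (q : ℂ) (m : ℕ) (α β γ : ℂ) (n : ℕ) :
    Submodule (Um q m) (Um q m) :=
  Submodule.span (Um q m)
    {uE q (fm q m) * uF q (fm q m) - algebraMap ℂ (Um q m) α,
     uK q (fm q m) - algebraMap ℂ (Um q m) β,
     uH q (fm q m) - algebraMap ℂ (Um q m) γ,
     uE q (fm q m),
     uF q (fm q m) ^ (n + 1)}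

/-- The left ideal `P_{1,∞} = U(EF - α) + U(K - β) + U(H - γ) + UE`. -/
noncomputable def P1inf (q : ℂ) (m : ℕ) (α β γ : ℂ) :
    Submodule (Um q m) (Um q m) :=
  Submodule.span (Um q m)
    {uE q (fm q m) * uF q (fm q m) - algebraMap ℂ (Um q m) α,
     uK q (fm q m) - algebraMap ℂ (Um q m) β,
     uH q (fm q m) - algebraMap ℂ (Um q m) γ,
     uE q (fm q m)}

/-- The left ideal `P_{∞,1} = U(EF - α) + U(K - β) + U(H - γ) + UF`. -/
noncomputable def Pinf1 (q : ℂ) (m : ℕ) (α β γ : ℂ) :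
    Submodule (Um q m) (Um q m) :=
  Submodule.span (Um q m)
    {uE q (fm q m) * uF q (fm q m) - algebraMap ℂ (Um q m) α,
     uK q (fm q m) - algebraMap ℂ (Um q m) β,
     uH q (fm q m) - algebraMap ℂ (Um q m) γ,
     uF q (fm q m)}

/-- The left ideal `P_{∞,∞} = U(EF - α) + U(K - β) + U(H - γ)`. -/
noncomputable def Pinfinf (q : ℂ) (m : ℕ) (α β γ : ℂ) :
    Submodule (Um q m) (Um q m) :=
  Submodule.span (Um q m)
    {uE q (fm q m) * uF q (fm q m) - algebraMap ℂ (Um q m) α,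
     uK q (fm q m) - algebraMap ℂ (Um q m) β,
     uH q (fm q m) - algebraMap ℂ (Um q m) γ}

/-- The scalar `c_k` in `E F^(k+1) v = c_(k+1) F^k v` for a highest weight vector `v` of
weight `(β, γ)`. -/
noncomputable def raiseCoeff (q : ℂ) (m : ℕ) (β γ : ℂ) (k : ℕ) : ℂ :=
  ∑ j ∈ Finset.range k, (q - q⁻¹)⁻¹ * (((q ^ 2)⁻¹ ^ j * β) ^ m - ((q ^ 2) ^ j * γ) ^ m)

section Coefficients

variable {q : ℂ} {m n : ℕ} {β γ : ℂ}

theorem pow_weight_eq (hγ : γ ≠ 0) (hn : (β / γ) ^ m = q ^ (2 * m * n)) :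
    β ^ m = γ ^ m * (q ^ (2 * m)) ^ n := by
  rw [div_pow, div_eq_iff (pow_ne_zero _ hγ)] at hn
  rw [hn, ← pow_mul, mul_comm]

theorem raiseCoeff_closed_form (hq0 : q ≠ 0) (hγ : γ ≠ 0)
    (hn : (β / γ) ^ m = q ^ (2 * m * n)) (k : ℕ) :
    raiseCoeff q m β γ k * ((q ^ (2 * m) - 1) * (q ^ (2 * m)) ^ k) =
      (q - q⁻¹)⁻¹ * (γ ^ m * ((q ^ (2 * m)) ^ k - 1) *
        ((q ^ (2 * m)) ^ (n + 1) - (q ^ (2 * m)) ^ k)) := by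
  have hQ : q ^ (2 * m) ≠ 0 := pow_ne_zero _ hq0
  induction k with
  | zero => simp [raiseCoeff]
  | succ k ih =>
    have h₁ : ((q ^ 2)⁻¹ ^ k * β) ^ m = ((q ^ (2 * m)) ^ k)⁻¹ * β ^ m := by
      rw [mul_pow, inv_pow, inv_pow, ← pow_mul, ← pow_mul, ← pow_mul]
      ring_nf
    have h₂ : ((q ^ 2) ^ k * γ) ^ m = (q ^ (2 * m)) ^ k * γ ^ m := by
      rw [mul_pow, ← pow_mul, ← pow_mul, ← pow_mul]
      ring_nf
    have hstep : raiseCoeff q m β γ (k + 1) = raiseCoeff q m β γ k +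
        (q - q⁻¹)⁻¹ * (((q ^ (2 * m)) ^ k)⁻¹ * β ^ m - (q ^ (2 * m)) ^ k * γ ^ m) := by
      rw [← h₁, ← h₂, raiseCoeff, Finset.sum_range_succ, raiseCoeff]
    rw [hstep, pow_weight_eq hγ hn]
    generalize q ^ (2 * m) = Q at *
    generalize raiseCoeff q m β γ k = c at *
    generalize (q - q⁻¹)⁻¹ = d at *
    have hk : (Q ^ k)⁻¹ * Q ^ k = 1 := inv_mul_cancel₀ (pow_ne_zero _ hQ)
    linear_combination Q * ih + d * γ ^ m * Q ^ n * (Q - 1) * Q * hk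

theorem raiseCoeff_ne_zero (hq0 : q ≠ 0) (hq : ∀ n : ℕ, 0 < n → q ^ n ≠ 1) (hm : 1 ≤ m)
    (hγ : γ ≠ 0) (hn : (β / γ) ^ m = q ^ (2 * m * n)) {k : ℕ} (hk : 0 < k) (hkn : k ≤ n) :
    raiseCoeff q m β γ k ≠ 0 := by
  intro h0
  have h := raiseCoeff_closed_form hq0 hγ hn k
  rw [h0, zero_mul, eq_comm] at h
  have hd : (q - q⁻¹)⁻¹ ≠ 0 := by
    refine inv_ne_zero fun h => hq 2 two_pos ?_
    field_simp at h
    linear_combination h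
  have h₁ : (q ^ (2 * m)) ^ k - 1 ≠ 0 := by
    rw [← pow_mul, sub_ne_zero]
    exact hq _ (by positivity)
  have h₂ : (q ^ (2 * m)) ^ (n + 1) - (q ^ (2 * m)) ^ k ≠ 0 := by
    obtain ⟨l, rfl⟩ := Nat.exists_eq_add_of_le hkn
    have hl : (q ^ (2 * m)) ^ (l + 1) ≠ 1 := by
      rw [← pow_mul]
      exact hq _ (by positivity)
    rw [add_assoc, pow_add, ← mul_sub_one]
    exact mul_ne_zero (pow_ne_zero _ (pow_ne_zero _ hq0)) (sub_ne_zero.2 hl)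
  exact mul_ne_zero hd (mul_ne_zero (mul_ne_zero (pow_ne_zero _ hγ) h₁) h₂) h

theorem raiseCoeff_succ_eq_zero (hq0 : q ≠ 0) (hq : ∀ n : ℕ, 0 < n → q ^ n ≠ 1) (hm : 1 ≤ m)
    (hγ : γ ≠ 0) (hn : (β / γ) ^ m = q ^ (2 * m * n)) :
    raiseCoeff q m β γ (n + 1) = 0 := by
  have h := raiseCoeff_closed_form hq0 hγ hn (n + 1)
  rw [sub_self, mul_zero, mul_zero] at h
  refine (mul_eq_zero.1 h).resolve_right (mul_ne_zero ?_ ?_)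
  · exact sub_ne_zero.2 (hq _ (by positivity))
  · exact pow_ne_zero _ (pow_ne_zero _ hq0)

end Coefficients

section Relations

variable (q : ℂ) (r : FA)

theorem uKi_mul_uK : uKi q r * uK q r = 1 := by
  simpa [uK, uKi] using RingQuot.mkAlgHom_rel ℂ (URel.KiK (q := q) (r := r))

theorem uHi_mul_uH : uHi q r * uH q r = 1 := by
  simpa [uH, uHi] using RingQuot.mkAlgHom_rel ℂ (URel.HiH (q := q) (r := r))

theorem uK_mul_uF : uK q r * uF q r = (q ^ 2)⁻¹ • (uF q r * uK q r) := by
  simpa [uK, uF] using RingQuot.mkAlgHom_rel ℂ (URel.KF (q := q) (r := r))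

theorem uH_mul_uF : uH q r * uF q r = q ^ 2 • (uF q r * uH q r) := by
  simpa [uH, uF] using RingQuot.mkAlgHom_rel ℂ (URel.HF (q := q) (r := r))

theorem uE_mul_uF (m : ℕ) : uE q (fm q m) * uF q (fm q m) =
    uF q (fm q m) * uE q (fm q m) +
      (q - q⁻¹)⁻¹ • (uK q (fm q m) ^ m - uH q (fm q m) ^ m) := by
  have h := RingQuot.mkAlgHom_rel ℂ (URel.EF (q := q) (r := fm q m))
  rw [map_sub, map_mul, map_mul] at h
  rw [← sub_eq_iff_eq_add']
  refine h.trans ?_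
  have hr : ∀ φ : FA →ₐ[ℂ] Um q m,
      φ (fm q m) = (q - q⁻¹)⁻¹ • (φ gK ^ m - φ gH ^ m) := fun φ => by
    simp only [fm, map_smul, map_sub, map_pow]
  exact hr _

theorem adjoin_generators_eq_top :
    Algebra.adjoin ℂ {uE q r, uF q r, uK q r, uKi q r, uH q r, uHi q r} = ⊤ := by
  rw [eq_top_iff]
  rintro x -
  obtain ⟨a, rfl⟩ := RingQuot.mkAlgHom_surjective ℂ (URel q r) x
  induction a using FreeAlgebra.induction with
  | grade0 c => simp
  | grade1 g => 
    cases g <;> exact Algebra.subset_adjoin (by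
      simp [uE, uF, uK, uKi, uH, uHi, gE, gF, gK, gKi, gH, gHi])
  | mul a b ha hb => simpa using mul_mem ha hb
  | add a b ha hb => simpa using add_mem ha hb

end Relations

section HighestWeight

variable {q : ℂ} {m : ℕ} {β γ : ℂ} {M : Type*} [AddCommGroup M] [Module ℂ M]
  [Module (Um q m) M] [IsScalarTower ℂ (Um q m) M] {v : M}

/-- `v` is a highest weight vector of weight `(β, γ)`. -/
structure IsHighestWeight (q : ℂ) (m : ℕ) (β γ : ℂ) {M : Type*} [AddCommGroup M] [Module ℂ M]
    [Module (Um q m) M] (v : M) : Prop where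
  raise : uE q (fm q m) • v = 0
  weightK : uK q (fm q m) • v = β • v
  weightH : uH q (fm q m) • v = γ • v

theorem smul_smul_comm (a : Um q m) (c : ℂ) (x : M) : a • c • x = c • a • x := by
  rw [← algebraMap_smul (Um q m) c x, ← mul_smul, ← Algebra.commutes, mul_smul, algebraMap_smul]

theorem pow_smul_eq {a : Um q m} {c : ℂ} {x : M} (h : a • x = c • x) (k : ℕ) :
    a ^ k • x = c ^ k • x := by
  induction k with
  | zero => simp
  | succ k ih => rw [pow_succ, mul_smul, h, smul_smul_comm, ih, smul_smul, pow_succ']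

theorem inv_smul_eq {a b : Um q m} {c : ℂ} {x : M} (hab : b * a = 1) (hc : c ≠ 0)
    (h : a • x = c • x) : b • x = c⁻¹ • x := by
  have : c • b • x = x := by rw [← smul_smul_comm, ← h, ← mul_smul, hab, one_smul]
  rw [← inv_smul_smul₀ hc (b • x), this]

namespace IsHighestWeight

theorem uK_smul (hv : IsHighestWeight q m β γ v) (k : ℕ) :
    uK q (fm q m) • uF q (fm q m) ^ k • v =
      ((q ^ 2)⁻¹ ^ k * β) • uF q (fm q m) ^ k • v := by
  induction k with
  | zero => simpa using hv.weightK
  | succ k ih =>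
    rw [pow_succ', mul_smul, ← mul_smul (uK _ _), uK_mul_uF, smul_assoc, mul_smul, ih,
      smul_smul_comm, smul_smul]
    ring_nf

theorem uH_smul (hv : IsHighestWeight q m β γ v) (k : ℕ) :
    uH q (fm q m) • uF q (fm q m) ^ k • v =
      ((q ^ 2) ^ k * γ) • uF q (fm q m) ^ k • v := by
  induction k with
  | zero => simpa using hv.weightH
  | succ k ih =>
    rw [pow_succ', mul_smul, ← mul_smul (uH _ _), uH_mul_uF, smul_assoc, mul_smul, ih,
      smul_smul_comm, smul_smul]
    ring_nf

theorem uE_smul (hv : IsHighestWeight q m β γ v) (k : ℕ) :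
    uE q (fm q m) • uF q (fm q m) ^ (k + 1) • v =
      raiseCoeff q m β γ (k + 1) • uF q (fm q m) ^ k • v := by
  have hstep (k : ℕ) : uE q (fm q m) • uF q (fm q m) ^ (k + 1) • v =
      uF q (fm q m) • uE q (fm q m) • uF q (fm q m) ^ k • v +
        ((q - q⁻¹)⁻¹ * (((q ^ 2)⁻¹ ^ k * β) ^ m - ((q ^ 2) ^ k * γ) ^ m)) •
          uF q (fm q m) ^ k • v := by
    rw [pow_succ', mul_smul, ← mul_smul (uE _ _), uE_mul_uF, add_smul, mul_smul, smul_assoc,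
      sub_smul, pow_smul_eq (hv.uK_smul k), pow_smul_eq (hv.uH_smul k), ← sub_smul,
      mul_smul (q - q⁻¹)⁻¹]
  induction k with
  | zero =>
    rw [hstep, pow_zero, one_smul, hv.raise]
    simp [raiseCoeff]
  | succ k ih =>
    rw [hstep, ih, smul_smul_comm, ← mul_smul (uF _ _), ← pow_succ', ← add_smul,
      raiseCoeff, raiseCoeff, ← Finset.sum_range_succ]

theorem uE_pow_smul_of_lt (hv : IsHighestWeight q m β γ v) {j k : ℕ} (hjk : j < k) :
    uE q (fm q m) ^ k • uF q (fm q m) ^ j • v = 0 := by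
  induction k generalizing j with
  | zero => omega
  | succ k ih =>
    rw [pow_succ, mul_smul]
    cases j with
    | zero => rw [pow_zero, one_smul, hv.raise, smul_zero]
    | succ j => rw [hv.uE_smul, smul_smul_comm, ih (by omega), smul_zero]

theorem uE_pow_smul_self (hv : IsHighestWeight q m β γ v) (k : ℕ) :
    uE q (fm q m) ^ k • uF q (fm q m) ^ k • v =
      (∏ j ∈ Finset.range k, raiseCoeff q m β γ (j + 1)) • v := by
  induction k with
  | zero => simp
  | succ k ih =>
    rw [pow_succ, mul_smul, hv.uE_smul, smul_smul_comm, ih, smul_smul, Finset.prod_range_succ,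
      mul_comm]

/-- The vectors `F^k v` with `k ≤ n` span the submodule generated by `v` if `F^(n+1) v = 0`. -/
theorem smul_mem_span (hv : IsHighestWeight q m β γ v) (hq0 : q ≠ 0) (hβ : β ≠ 0) (hγ : γ ≠ 0)
    {n : ℕ} (hF : uF q (fm q m) ^ (n + 1) • v = 0) (a : Um q m) :
    a • v ∈ Submodule.span ℂ ((fun k => uF q (fm q m) ^ k • v) '' Set.Iio (n + 1)) := by
  set W := Submodule.span ℂ ((fun k => uF q (fm q m) ^ k • v) '' Set.Iio (n + 1)) with hW
  have hmem : ∀ k < n + 1, uF q (fm q m) ^ k • v ∈ W := fun k hk =>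
    Submodule.subset_span ⟨k, hk, rfl⟩
  have hlin : ∀ b : Um q m, (∀ k < n + 1, b • uF q (fm q m) ^ k • v ∈ W) →
      ∀ w ∈ W, b • w ∈ W := by
    intro b hb w hw
    induction hw using Submodule.span_induction with
    | mem x hx => obtain ⟨k, hk, rfl⟩ := hx; exact hb k hk
    | zero => simp
    | add x y _ _ hx hy => rw [smul_add]; exact add_mem hx hy
    | smul c x _ hx => rw [smul_smul_comm]; exact W.smul_mem c hx
  have hstable : ∀ w ∈ W, a • w ∈ W := by
    have ha : a ∈ Algebra.adjoin ℂ {uE q (fm q m), uF q (fm q m), uK q (fm q m),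
        uKi q (fm q m), uH q (fm q m), uHi q (fm q m)} := by
      rw [adjoin_generators_eq_top]; trivial
    induction ha using Algebra.adjoin_induction with
    | mem x hx =>
      refine hlin x fun k hk => ?_
      rcases hx with rfl | rfl | rfl | rfl | rfl | rfl
      · cases k with
        | zero => rw [pow_zero, one_smul, hv.raise]; exact W.zero_mem
        | succ k => rw [hv.uE_smul]; exact W.smul_mem _ (hmem k (by omega))
      · rw [← mul_smul, ← pow_succ']
        rcases Nat.lt_succ_iff_lt_or_eq.1 hk with h | rfl
        · exact hmem _ (by omega)
        · rw [hF]; exact W.zero_mem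
      · rw [hv.uK_smul]; exact W.smul_mem _ (hmem k hk)
      · rw [inv_smul_eq (uKi_mul_uK _ _) (by positivity) (hv.uK_smul k)]
        exact W.smul_mem _ (hmem k hk)
      · rw [hv.uH_smul]; exact W.smul_mem _ (hmem k hk)
      · rw [inv_smul_eq (uHi_mul_uH _ _) (by positivity) (hv.uH_smul k)]
        exact W.smul_mem _ (hmem k hk)
    | algebraMap c => intro w hw; rw [algebraMap_smul]; exact W.smul_mem c hw
    | add x y _ _ hx hy => intro w hw; rw [add_smul]; exact add_mem (hx w hw) (hy w hw)
    | mul x y _ _ hx hy => intro w hw; rw [mul_smul]; exact hx _ (hy w hw)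
  exact hstable v (by simpa using hmem 0 (by omega))

theorem mem_span_singleton (hv : IsHighestWeight q m β γ v) {k : ℕ}
    (hc : ∀ j, 0 < j → j < k → raiseCoeff q m β γ j ≠ 0) {x : M} (hx0 : x ≠ 0)
    (hx : x ∈ Submodule.span ℂ ((fun k => uF q (fm q m) ^ k • v) '' Set.Iio k)) :
    v ∈ Submodule.span (Um q m) {x} := by
  induction k generalizing x with
  | zero => simp at hx; exact absurd hx hx0
  | succ k ih =>
    have hIio : Set.Iio (k + 1) = insert k (Set.Iio k) := by ext; simp
    rw [hIio, Set.image_insert_eq, Submodule.mem_span_insert] at hx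
    obtain ⟨a, w, hw, rfl⟩ := hx
    by_cases ha : a = 0
    · subst ha
      rw [zero_smul, zero_add] at hx0 ⊢
      exact ih (fun j h0 hj => hc j h0 (by omega)) hx0 hw
    · have hEw : uE q (fm q m) ^ k • w = 0 := by
        clear hx0
        induction hw using Submodule.span_induction with
        | mem x hx => obtain ⟨j, hj, rfl⟩ := hx; exact hv.uE_pow_smul_of_lt hj
        | zero => simp
        | add x y _ _ hx hy => rw [smul_add, hx, hy, add_zero]
        | smul c x _ hx => rw [smul_smul_comm, hx, smul_zero]
      set C := a * ∏ j ∈ Finset.range k, raiseCoeff q m β γ (j + 1) with hC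
      have hC0 : C ≠ 0 := mul_ne_zero ha <| Finset.prod_ne_zero_iff.2 fun j hj =>
        hc _ (by omega) (by simpa using hj)
      rw [Submodule.mem_span_singleton]
      refine ⟨algebraMap ℂ (Um q m) C⁻¹ * uE q (fm q m) ^ k, ?_⟩
      rw [mul_smul, smul_add, hEw, add_zero, smul_smul_comm, hv.uE_pow_smul_self, smul_smul,
        algebraMap_smul, ← hC, inv_smul_smul₀ hC0]

end IsHighestWeight

end HighestWeight

section DualVerma

/-- The action of the generators on sequences, dual to a Verma module: `E` is the backward
shift and `F` the weighted forward shift. -/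
noncomputable def dualVermaGen (q : ℂ) (m : ℕ) (β γ : ℂ) : Gen → Module.End ℂ (ℕ → ℂ)
  | .E => { toFun := fun f i => f (i + 1), map_add' := fun _ _ => rfl, map_smul' := fun _ _ => rfl }
  | .F =>
    { toFun := fun f i => raiseCoeff q m β γ i * f (i - 1)
      map_add' := fun _ _ => by ext; simp [mul_add]
      map_smul' := fun _ _ => by ext; simp [mul_left_comm] }
  | .K => LinearMap.mulLeft ℂ fun i => (q ^ 2)⁻¹ ^ i * β
  | .Kinv => LinearMap.mulLeft ℂ fun i => ((q ^ 2)⁻¹ ^ i * β)⁻¹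
  | .H => LinearMap.mulLeft ℂ fun i => (q ^ 2) ^ i * γ
  | .Hinv => LinearMap.mulLeft ℂ fun i => ((q ^ 2) ^ i * γ)⁻¹

variable {q : ℂ} {m : ℕ} {β γ : ℂ}

theorem raiseCoeff_zero : raiseCoeff q m β γ 0 = 0 := by simp [raiseCoeff]

theorem dualVermaGen_rel (hq0 : q ≠ 0) (hβ : β ≠ 0) (hγ : γ ≠ 0) ⦃a b : FA⦄
    (h : URel q (fm q m) a b) :
    FreeAlgebra.lift ℂ (dualVermaGen q m β γ) a = FreeAlgebra.lift ℂ (dualVermaGen q m β γ) b := by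
  have hK (i : ℕ) : (q ^ 2)⁻¹ ^ i * β ≠ 0 := by positivity
  have hH (i : ℕ) : (q ^ 2) ^ i * γ ≠ 0 := by positivity
  have hq2 : q ^ 2 ≠ 0 := by positivity
  cases h <;> ext1 f <;> funext i <;>
    simp only [gE, gF, gK, gKi, gH, gHi, fm, map_mul, map_sub, map_smul, map_pow, map_one,
      FreeAlgebra.lift_ι_apply, dualVermaGen, LinearMap.pow_mulLeft, Module.End.mul_apply,
      Module.End.one_apply, LinearMap.sub_apply, LinearMap.smul_apply, LinearMap.mulLeft_apply,
      LinearMap.coe_mk, AddHom.coe_mk, Pi.mul_apply, Pi.sub_apply, Pi.smul_apply, Pi.pow_apply,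
      smul_eq_mul]
  case KKi => rw [mul_inv_cancel_left₀ (hK i)]
  case KiK => rw [inv_mul_cancel_left₀ (hK i)]
  case HHi => rw [mul_inv_cancel_left₀ (hH i)]
  case HiH => rw [inv_mul_cancel_left₀ (hH i)]
  case KH => ring
  case KE =>
    rw [pow_succ (q ^ 2)⁻¹ i]
    linear_combination (- (q ^ 2)⁻¹ ^ i * β * f (i + 1)) * mul_inv_cancel₀ hq2
  case HE =>
    rw [pow_succ (q ^ 2) i]
    linear_combination (- (q ^ 2) ^ i * γ * f (i + 1)) * mul_inv_cancel₀ hq2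
  case KF =>
    cases i with
    | zero => simp [raiseCoeff_zero]
    | succ i => rw [Nat.add_sub_cancel]; ring
  case HF =>
    cases i with
    | zero => simp [raiseCoeff_zero]
    | succ i => rw [Nat.add_sub_cancel]; ring
  case EF =>
    have hc : raiseCoeff q m β γ (i + 1) = raiseCoeff q m β γ i +
        (q - q⁻¹)⁻¹ * (((q ^ 2)⁻¹ ^ i * β) ^ m - ((q ^ 2) ^ i * γ) ^ m) := by
      rw [raiseCoeff, Finset.sum_range_succ, raiseCoeff]
    rw [Nat.add_sub_cancel, hc]
    cases i with
    | zero => simp only [raiseCoeff_zero]; ring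
    | succ i => rw [Nat.add_sub_cancel]; ring

/-- The dual Verma representation of `U_q(f_m(K,H))` on sequences. -/
noncomputable def dualVerma (hq0 : q ≠ 0) (hβ : β ≠ 0) (hγ : γ ≠ 0) :
    Um q m →ₐ[ℂ] Module.End ℂ (ℕ → ℂ) :=
  RingQuot.liftAlgHom ℂ ⟨FreeAlgebra.lift ℂ (dualVermaGen q m β γ), dualVermaGen_rel hq0 hβ hγ⟩

theorem dualVerma_mk (hq0 : q ≠ 0) (hβ : β ≠ 0) (hγ : γ ≠ 0) (g : Gen) :
    dualVerma hq0 hβ hγ (RingQuot.mkAlgHom ℂ (URel q (fm q m)) (FreeAlgebra.ι ℂ g)) =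
      dualVermaGen q m β γ g := by
  rw [dualVerma, RingQuot.liftAlgHom_mkAlgHom_apply, FreeAlgebra.lift_ι_apply]

theorem dualVermaGen_F_pow (k : ℕ) :
    (dualVermaGen q m β γ .F ^ k) (Pi.single 0 1) =
      Pi.single k (∏ j ∈ Finset.range k, raiseCoeff q m β γ (j + 1)) := by
  induction k with
  | zero => simp
  | succ k ih =>
    rw [pow_succ', Module.End.mul_apply, ih, Finset.prod_range_succ]
    funext i
    cases i with
    | zero => simp [dualVermaGen, raiseCoeff_zero]
    | succ i =>
      rcases eq_or_ne i k with rfl | h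
      · simp [dualVermaGen, mul_comm]
      · simp [dualVermaGen, h]

end DualVerma

theorem one_notMem_P1n (q : ℂ) (hq0 : q ≠ 0) (hq : ∀ n : ℕ, 0 < n → q ^ n ≠ 1)
    (m : ℕ) (hm : 1 ≤ m) (α β γ : ℂ) (hβ : β ≠ 0) (hγ : γ ≠ 0)
    (hα : α = (β ^ m - γ ^ m) / (q - q⁻¹))
    (n : ℕ) (hn : (β / γ) ^ m = q ^ (2 * m * n)) :
    (1 : Um q m) ∉ P1n q m α β γ n := by
  have key : ∀ x ∈ P1n q m α β γ n, dualVerma hq0 hβ hγ x (Pi.single 0 1) = 0 := by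
    intro x hx
    induction hx using Submodule.span_induction with
    | mem x hx =>
      rcases hx with rfl | rfl | rfl | rfl | rfl <;>
        simp only [uE, uF, uK, uH, gE, gF, gK, gH, map_sub, map_mul, map_pow, dualVerma_mk,
          AlgHom.commutes]
      · ext i
        rw [LinearMap.sub_apply, Module.algebraMap_end_apply]
        cases i <;> simp [dualVermaGen, raiseCoeff, hα, div_eq_inv_mul]
      · ext i
        cases i <;> simp [dualVermaGen, Module.algebraMap_end_apply]
      · ext i
        cases i <;> simp [dualVermaGen, Module.algebraMap_end_apply]
      · ext i
        simp [dualVermaGen]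
      · rw [dualVermaGen_F_pow, Finset.prod_range_succ, raiseCoeff_succ_eq_zero hq0 hq hm hγ hn,
          mul_zero, Pi.single_zero]
    | zero => simp
    | add x y _ _ hx hy => simp [hx, hy]
    | smul a x _ hx => simp [hx]
  intro h
  simpa using congrFun (key 1 h) 0

/-- If `α = (β^m - γ^m)/(q - q⁻¹)` and `(β/γ)^m = q^{2mn}` for some
`n ≥ 0`, then `U/P_{1,n+1}` is a nonzero finite-dimensional irreducible representation
of `U = U_q(f_m(K,H))`. -/
theorem stmt2 (q : ℂ) (hq0 : q ≠ 0) (hq : ∀ n : ℕ, 0 < n → q ^ n ≠ 1)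
    (m : ℕ) (hm : 1 ≤ m) (α β γ : ℂ) (hβ : β ≠ 0) (hγ : γ ≠ 0)
    (hα : α = (β ^ m - γ ^ m) / (q - q⁻¹))
    (n : ℕ) (hn : (β / γ) ^ m = q ^ (2 * m * n)) :
    Nontrivial (Um q m ⧸ P1n q m α β γ n) ∧
    FiniteDimensional ℂ (Um q m ⧸ P1n q m α β γ n) ∧
    IsSimpleModule (Um q m) (Um q m ⧸ P1n q m α β γ n) := by
  have hmk (a : Um q m) : a • (Submodule.Quotient.mk 1 : Um q m ⧸ P1n q m α β γ n) =
      Submodule.Quotient.mk a := by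
    rw [← Submodule.Quotient.mk_smul, smul_eq_mul, mul_one]
  have hscal (a : Um q m) (c : ℂ) (h : a - algebraMap ℂ (Um q m) c ∈ P1n q m α β γ n) :
      a • (Submodule.Quotient.mk 1 : Um q m ⧸ P1n q m α β γ n) =
        c • (Submodule.Quotient.mk 1 : Um q m ⧸ P1n q m α β γ n) := by
    rw [← algebraMap_smul (Um q m) c
      (Submodule.Quotient.mk 1 : Um q m ⧸ P1n q m α β γ n), hmk, hmk]
    exact (Submodule.Quotient.eq _).2 h
  have hv : IsHighestWeight q m β γ (Submodule.Quotient.mk 1 : Um q m ⧸ P1n q m α β γ n) := by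
    refine ⟨?_, hscal _ _ (Submodule.subset_span (by simp)),
      hscal _ _ (Submodule.subset_span (by simp))⟩
    rw [hmk, Submodule.Quotient.mk_eq_zero]
    exact Submodule.subset_span (by simp)
  have hF : uF q (fm q m) ^ (n + 1) •
      (Submodule.Quotient.mk 1 : Um q m ⧸ P1n q m α β γ n) = 0 := by
    rw [hmk, Submodule.Quotient.mk_eq_zero]
    exact Submodule.subset_span (by simp)
  have hspan (x : Um q m ⧸ P1n q m α β γ n) : x ∈ Submodule.span ℂ
      ((fun k => uF q (fm q m) ^ k • (Submodule.Quotient.mk 1 : Um q m ⧸ P1n q m α β γ n)) ''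
        Set.Iio (n + 1)) := by
    obtain ⟨a, rfl⟩ := Submodule.Quotient.mk_surjective _ x
    rw [← hmk a]
    exact hv.smul_mem_span hq0 hβ hγ hF a
  have hnt : Nontrivial (Um q m ⧸ P1n q m α β γ n) :=
    nontrivial_of_ne (Submodule.Quotient.mk 1) 0 fun h =>
      one_notMem_P1n q hq0 hq m hm α β γ hβ hγ hα n hn ((Submodule.Quotient.mk_eq_zero _).1 h)
  refine ⟨hnt, ?_, ?_⟩
  · exact Module.Finite.of_fg_top (Submodule.fg_def.2
      ⟨_, (Set.finite_Iio (n + 1)).image _, eq_top_iff.2 fun x _ => hspan x⟩)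
  · rw [isSimpleModule_iff_toSpanSingleton_surjective]
    refine ⟨hnt, fun x hx y => ?_⟩
    have hvx := hv.mem_span_singleton
      (fun j h0 hj => raiseCoeff_ne_zero hq0 hq hm hγ hn h0 (by omega)) hx (hspan x)
    obtain ⟨a, ha⟩ := Submodule.mem_span_singleton.1 hvx
    obtain ⟨b, rfl⟩ := Submodule.Quotient.mk_surjective _ y
    exact ⟨b * a, by rw [LinearMap.toSpanSingleton_apply, mul_smul, ha, hmk]⟩
end
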